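/- arXiv:2012.10624 — 3 statements merged into one kernel-verified Lean document; each statement's English description precedes it below -/
import Mathlib

section
/- Let k ≥ 3 be an integer and let G be a 3-connected finite simple graph of minimum degree at least k. If G contains a triangle K_3 as a subgraph but does not contain K_4^- as a subgraph, then G contains k cycles of consecutive lengths. -/
/-- `G` contains a cycle of length `n`. -/
def HasCycleLength {V : Type*} (G : SimpleGraph V) (n : ℕ) : Prop :=
  ∃ (u : V) (c : G.Walk u u), c.IsCycle ∧ c.length = n

/-- A finite graph is `n`-connected: it has more than `n` vertices and remains connected after
deleting any set of fewer than `n` vertices. -/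
def KConnected (n : ℕ) {V : Type*} [Fintype V] (G : SimpleGraph V) : Prop :=
  n < Fintype.card V ∧ ∀ s : Finset V, s.card < n → (G.induce ((↑s : Set V)ᶜ)).Connected

/-- `G` contains `K₄⁻` (the complete graph on four vertices minus an edge) as a subgraph. -/
def ContainsK4Minus {V : Type*} (G : SimpleGraph V) : Prop :=
  ∃ a b c d : V, c ≠ d ∧ G.Adj a b ∧ G.Adj a c ∧ G.Adj a d ∧ G.Adj b c ∧ G.Adj b d

namespace CL
open scoped Classical
open Finset

/-- `EP H S u v n`: there is a path from `u` to `v` with vertex set exactly `S`, length `n`. -/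
inductive EP {V : Type*} (H : SimpleGraph V) : Finset V → V → V → ℕ → Prop
  | nil (u : V) : EP H {u} u u 0
  | cons {S : Finset V} {u w v : V} {n : ℕ} (hu : u ∉ S) (h : H.Adj u w) (hp : EP H S w v n) :
      EP H (insert u S) u v (n + 1)

section
variable {V : Type*} {H : SimpleGraph V}

theorem EP.left {S : Finset V} {u v n} (h : EP H S u v n) : u ∈ S := by
  cases h <;> simp

theorem EP.right {S : Finset V} {u v n} (h : EP H S u v n) : v ∈ S := by
  induction h with
  | nil => simp
  | cons _ _ _ ih => simp [ih]

theorem EP.app {S S' : Finset V} {u v v' w n m} (h : EP H S u v n) (h' : EP H S' v' w m)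
    (ha : H.Adj v v') (hd : ∀ s ∈ S, s ∉ S') : EP H (S ∪ S') u w (n + m + 1) := by
  induction h with
  | nil u =>
    have := EP.cons (hd u (by simp)) ha h'
    rw [show ({u} : Finset V) ∪ S' = insert u S' from rfl]
    convert this using 1
    omega
  | @cons S u w' v n hu h hp ih =>
    have h1 := ih ha (fun s hs => hd s (by simp [hs]))
    have : EP H (insert u (S ∪ S')) u w (n + m + 1 + 1) := by
      refine EP.cons ?_ h h1
      have := hd u (by simp)
      simp [hu, this]
    rw [Finset.insert_union]
    convert this using 1
    omega

theorem EP.rev {S : Finset V} {u v n} (h : EP H S u v n) : EP H S v u n := by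
  induction h with
  | nil u => exact EP.nil u
  | @cons S u w v n hu h hp ih =>
    have := ih.app (EP.nil u) h.symm (by
      intro s hs; simp only [Finset.mem_singleton]; rintro rfl; exact hu hs)
    rw [Finset.union_comm] at this
    exact this

theorem EP.join {S S' : Finset V} {u v w n m} (h : EP H S u v n) (h' : EP H S' v w m)
    (hd : ∀ s ∈ S, s ∈ S' → s = v) : EP H (S ∪ S') u w (n + m) := by
  induction h with
  | nil u =>
    have : ({u} : Finset V) ∪ S' = S' := by
      ext t; simp; rintro rfl; exact h'.left
    rw [this]; simpa using h'
  | @cons S u w' v n hu h hp ih =>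
    have h1 := ih h' (fun s hs => hd s (by simp [hs]))
    rw [Finset.insert_union]
    have h2 : u ∉ S ∪ S' := by
      simp only [Finset.mem_union, not_or]
      refine ⟨hu, fun hu' => ?_⟩
      have := hd u (by simp) hu'
      subst this
      exact hu hp.right
    have := EP.cons h2 h h1
    convert this using 1
    omega

theorem EP.split {S : Finset V} {u v n} (h : EP H S u v n) {p : V} (hp : p ∈ S) :
    ∃ S1 S2 n1 n2, EP H S1 u p n1 ∧ EP H S2 p v n2 ∧ S1 ⊆ S ∧ S2 ⊆ S ∧
      (∀ s ∈ S1, s ∈ S2 → s = p) := by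
  induction h with
  | nil u =>
    simp at hp; subst hp
    exact ⟨{p}, {p}, 0, 0, EP.nil p, EP.nil p, by simp, by simp, by simp⟩
  | @cons S u w v n hu h hq ih =>
    by_cases hpu : p = u
    · subst hpu
      exact ⟨{p}, insert p S, 0, n + 1, EP.nil p, EP.cons hu h hq, by simp, by simp, by simp⟩
    · have hpS : p ∈ S := by simpa [hpu] using hp
      obtain ⟨S1, S2, n1, n2, h1, h2, h3, h4, h5⟩ := ih hpS
      refine ⟨insert u S1, S2, n1 + 1, n2, EP.cons (fun hh => hu (h3 hh)) h h1, h2,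
        Finset.insert_subset_insert _ h3, h4.trans (Finset.subset_insert _ _), ?_⟩
      intro s hs hs2
      rcases Finset.mem_insert.1 hs with rfl | hs
      · exact absurd (h4 hs2) hu
      · exact h5 s hs hs2

theorem EP.firstHit {S : Finset V} {u v n} (h : EP H S u v n) (Z : V → Prop) (hv : Z v) :
    ∃ z S' n', Z z ∧ EP H S' u z n' ∧ S' ⊆ S ∧ ∀ s ∈ S', Z s → s = z := by
  induction h with
  | nil u => exact ⟨u, {u}, 0, hv, EP.nil u, by simp, by simp⟩
  | @cons S u w v n hu h hq ih =>
    by_cases hZ : Z u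
    · exact ⟨u, {u}, 0, hZ, EP.nil u, by simp, by simp⟩
    · obtain ⟨z, S', n', h1, h2, h3, h4⟩ := ih hv
      refine ⟨z, insert u S', n' + 1, h1, EP.cons (fun hh => hu (h3 hh)) h h2,
        Finset.insert_subset_insert _ h3, ?_⟩
      intro s hs hs2
      rcases Finset.mem_insert.1 hs with rfl | hs
      · exact absurd hs2 hZ
      · exact h4 s hs hs2

theorem EP.cross {S : Finset V} {u v n} (h : EP H S u v n) (D : Finset V) (hu' : u ∉ D)
    (hv : v ∈ D) :
    ∃ w S' n', (∃ e ∈ D, H.Adj e w) ∧ EP H S' u w n' ∧ S' ⊆ S ∧ (∀ s ∈ S', s ∉ D) ∧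
      ∀ s ∈ S', (∃ e ∈ D, H.Adj e s) → s = w := by
  induction h with
  | nil u => exact absurd hv hu'
  | @cons S u w v n hu h hq ih =>
    by_cases hZ : ∃ e ∈ D, H.Adj e u
    · exact ⟨u, {u}, 0, hZ, EP.nil u, by simp, by simp [hu'], by simp⟩
    · have hw : w ∉ D := fun hw => hZ ⟨w, hw, h.symm⟩
      obtain ⟨z, S', n', h1, h2, h3, h4, h5⟩ := ih hw hv
      refine ⟨z, insert u S', n' + 1, h1, EP.cons (fun hh => hu (h3 hh)) h h2,
        Finset.insert_subset_insert _ h3, ?_, ?_⟩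
      · intro s hs
        rcases Finset.mem_insert.1 hs with rfl | hs
        · exact hu'
        · exact h4 s hs
      · intro s hs hs2
        rcases Finset.mem_insert.1 hs with rfl | hs
        · exact absurd hs2 hZ
        · exact h5 s hs hs2

theorem EP.closed {S : Finset V} {u v n} (h : EP H S u v n) (K : Finset V) (hS : S ⊆ K)
    (X : V → Prop) (hX : ∀ e, X e → ∀ w ∈ K, H.Adj e w → X w) (hu : X u) : X v := by
  induction h with
  | nil u => exact hu
  | @cons S u w v n hu' h hq ih =>
    have hS' : S ⊆ K := (Finset.subset_insert _ _).trans hS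
    exact ih hS' (hX _ hu _ (hS' hq.left) h)

/-- change of graph -/
theorem EP.mono {H' : SimpleGraph V} {S : Finset V} {u v n} (h : EP H S u v n)
    (hh : ∀ a ∈ S, ∀ b ∈ S, H.Adj a b → H'.Adj a b) : EP H' S u v n := by
  induction h with
  | nil u => exact EP.nil u
  | @cons S u w v n hu' h hq ih =>
    refine EP.cons hu' (hh _ (by simp) _ (by simp [hq.left]) h) (ih ?_)
    intro a ha b hb
    exact hh a (by simp [ha]) b (by simp [hb])

noncomputable def comp (H : SimpleGraph V) (K : Finset V) (v : V) : Finset V :=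
  K.filter (fun w => ∃ S n, S ⊆ K ∧ EP H S v w n)

theorem comp_sub {K : Finset V} {v : V} : comp H K v ⊆ K := Finset.filter_subset _ _

theorem comp_self {K : Finset V} {v : V} (hv : v ∈ K) : v ∈ comp H K v := by
  simp only [comp, Finset.mem_filter]
  exact ⟨hv, {v}, 0, by simpa using hv, EP.nil v⟩

theorem comp_closed {K : Finset V} {v w w' : V} (hw : w ∈ comp H K v) (hw' : w' ∈ K)
    (h : H.Adj w w') : w' ∈ comp H K v := by
  simp only [comp, Finset.mem_filter] at hw ⊢
  obtain ⟨_, S, n, hS, hp⟩ := hw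
  refine ⟨hw', ?_⟩
  by_cases h1 : w' ∈ S
  · obtain ⟨S1, S2, n1, n2, h1, h2, h3, h4, h5⟩ := hp.split h1
    exact ⟨S1, n1, h3.trans hS, h1⟩
  · refine ⟨S ∪ {w'}, _, ?_, hp.app (EP.nil w') h ?_⟩
    · intro t ht
      simp only [Finset.mem_union, Finset.mem_singleton] at ht
      rcases ht with ht | rfl
      · exact hS ht
      · exact hw'
    · intro s hs; simp only [Finset.mem_singleton]; rintro rfl; exact h1 hs

theorem comp_conn {K : Finset V} {v : V} (hv : v ∈ K) {E : Finset V} (hE : E ⊆ comp H K v)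
    (hne : E.Nonempty) (hc : ∀ e ∈ E, ∀ w ∈ comp H K v, H.Adj e w → w ∈ E) :
    E = comp H K v := by
  have key : ∀ w ∈ comp H K v, ∃ S n, S ⊆ K ∧ EP H S v w n := by
    intro w hw; exact (Finset.mem_filter.1 hw).2
  by_cases hvE : v ∈ E
  · refine Finset.Subset.antisymm hE fun w hw => ?_
    obtain ⟨S, n, hS, hp⟩ := key w hw
    exact hp.closed K hS (· ∈ E) (fun e he w hw h => hc e he w (comp_closed (hE he) hw h) h) hvE
  · obtain ⟨e, he⟩ := hne
    obtain ⟨S, n, hS, hp⟩ := key e (hE he)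
    have := hp.closed K hS (fun t => t ∈ comp H K v ∧ t ∉ E) (by
      rintro t ⟨ht, htE⟩ w hw h
      have hw' := comp_closed ht hw h
      exact ⟨hw', fun hwE => htE (hc w hwE t ht h.symm)⟩) ⟨comp_self hv, hvE⟩
    exact absurd he this.2

theorem comp_path {K : Finset V} {v a b : V} (ha : a ∈ comp H K v) (hb : b ∈ comp H K v) :
    ∃ S n, S ⊆ K ∧ EP H S a b n := by
  have ha' := (Finset.mem_filter.1 ha)
  obtain ⟨haK, S, n, hS, hp⟩ := ha'
  obtain ⟨hbK, S2, n2, hS2, hp2⟩ := (Finset.mem_filter.1 hb)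
  have hv : v ∈ comp H K a := by
    simp only [comp, Finset.mem_filter]
    exact ⟨hS hp.left, S, n, hS, hp.rev⟩
  have : b ∈ comp H K a :=
    hp2.closed K hS2 (· ∈ comp H K a) (fun e he w hw h => comp_closed he hw h) hv
  exact (Finset.mem_filter.1 this).2

/-! ### spans -/
def Span (L : ℕ → Prop) (r : ℕ) : Prop :=
  ∃ p q, p + r ≤ q ∧ L p ∧ L q ∧ ∀ n, p ≤ n → n < q → L n ∨ L (n + 1)

theorem Span.add {L1 L2 L : ℕ → Prop} {r1 r2 r c : ℕ} (h1 : Span L1 r1) (h2 : Span L2 r2)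
    (h : ∀ a b, L1 a → L2 b → L (a + b + c)) (hr : r ≤ r1 + r2) : Span L r := by
  obtain ⟨p1, q1, a1, b1, c1, d1⟩ := h1
  obtain ⟨p2, q2, a2, b2, c2, d2⟩ := h2
  refine ⟨p1 + p2 + c, q1 + q2 + c, by omega, h _ _ b1 b2, h _ _ c1 c2, fun n hn hn' => ?_⟩
  by_cases hlt : n < q1 + p2 + c
  · rcases d1 (n - p2 - c) (by omega) (by omega) with h3 | h3
    · left
      have := h _ _ h3 b2
      rwa [show n - p2 - c + p2 + c = n by omega] at this
    · right
      have := h _ _ h3 b2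
      rwa [show n - p2 - c + 1 + p2 + c = n + 1 by omega] at this
  · rcases d2 (n - q1 - c) (by omega) (by omega) with h3 | h3
    · left
      have := h _ _ c1 h3
      rwa [show q1 + (n - q1 - c) + c = n by omega] at this
    · right
      have := h _ _ c1 h3
      rwa [show q1 + (n - q1 - c + 1) + c = n + 1 by omega] at this

theorem span0 {L : ℕ → Prop} {p : ℕ} (h : L p) : Span L 0 :=
  ⟨p, p, by omega, h, h, fun n h1 h2 => by omega⟩
theorem span1 {L : ℕ → Prop} {p : ℕ} (h : L p) (h' : L (p + 1)) : Span L 1 :=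
  ⟨p, p + 1, by omega, h, h', fun n h1 h2 => by left; rwa [show n = p by omega]⟩
theorem span2 {L : ℕ → Prop} {p : ℕ} (h : L p) (h' : L (p + 2)) : Span L 2 := by
  refine ⟨p, p + 2, by omega, h, h', fun n h1 h2 => ?_⟩
  rcases (show n = p ∨ n = p + 1 by omega) with rfl | rfl
  · exact Or.inl h
  · exact Or.inr h'

theorem Span.mono {L : ℕ → Prop} {r r' : ℕ} (h : Span L r) (hr : r' ≤ r) : Span L r' := by
  obtain ⟨p, q, a, b⟩ := h
  exact ⟨p, q, by omega, b⟩

theorem Span.shift {L1 L : ℕ → Prop} {r c : ℕ} (h1 : Span L1 r)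
    (h : ∀ a, L1 a → L (a + c)) : Span L r :=
  h1.add (L2 := fun n => n = 0) (c := c) (r2 := 0) (span0 rfl)
    (by rintro a b ha rfl; exact h a ha) (by omega)

end
end CL

namespace CL
open scoped Classical
open Finset
variable {V : Type*} {H : SimpleGraph V}

def LAB (H : SimpleGraph V) (U : Finset V) (A B : V → Prop) (m : ℕ) : Prop :=
  ∃ S u u', S ⊆ U ∧ A u ∧ B u' ∧ EP H S u u' m

def LL (H : SimpleGraph V) (J : Finset V) (x y : V) (m : ℕ) : Prop :=
  ∃ S, S ⊆ J ∧ EP H S x y m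

noncomputable def JJ (x y : V) (U : Finset V) : Finset V := insert x (insert y U)

theorem mem_JJ {x y w : V} {U : Finset V} : w ∈ JJ x y U ↔ w = x ∨ w = y ∨ w ∈ U := by
  simp [JJ]

def IHh (H : SimpleGraph V) (U : Finset V) : Prop :=
  ∀ (U' : Finset V) (A B : V → Prop) (d' : ℕ), U' ⊂ U → U'.Nonempty →
    (∀ v ∈ U', d' ≤ #(U'.filter (H.Adj v)) + (if A v then 1 else 0) + (if B v then 1 else 0)) →
    (∀ E ⊆ U', E.Nonempty → (∀ e ∈ E, ∀ w ∈ U', H.Adj e w → w ∈ E) →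
      (∃ e ∈ E, A e) ∧ (∃ e ∈ E, B e)) →
    (∀ E ⊆ U', E.Nonempty → ∀ c ∈ U', c ∉ E →
      (∀ e ∈ E, ∀ w ∈ U', H.Adj e w → w ∈ E ∨ w = c) → ∃ e ∈ E, A e ∨ B e) →
    Span (LAB H U' A B) (d' - 2)

theorem IHh.comp {U : Finset V} (ih : IHh H U) {K : Finset V} {v : V} (hv : v ∈ K)
    (A B : V → Prop) (d' : ℕ) (hs : comp H K v ⊂ U)
    (hdeg : ∀ v' ∈ comp H K v, d' ≤ #((comp H K v).filter (H.Adj v')) +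
      (if A v' then 1 else 0) + (if B v' then 1 else 0))
    (hA : ∃ e ∈ comp H K v, A e) (hB : ∃ e ∈ comp H K v, B e)
    (h1 : ∀ E ⊆ comp H K v, E.Nonempty → ∀ c ∈ comp H K v, c ∉ E →
      (∀ e ∈ E, ∀ w ∈ comp H K v, H.Adj e w → w ∈ E ∨ w = c) → ∃ e ∈ E, A e ∨ B e) :
    Span (LAB H (comp H K v) A B) (d' - 2) := by
  refine ih _ A B d' hs ⟨v, comp_self hv⟩ hdeg ?_ h1
  intro E hE hne hc
  rw [comp_conn hv hE hne hc]
  exact ⟨hA, hB⟩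

structure St (H : SimpleGraph V) (x y : V) (U : Finset V) (d : ℕ) : Prop where
  hxy : x ≠ y
  hx : x ∉ U
  hy : y ∉ U
  ne : U.Nonempty
  conn2 : ∀ E ⊆ U, E.Nonempty → ∀ p, ∃ e ∈ E, ∃ w ∈ JJ x y U, H.Adj e w ∧ w ∉ E ∧ w ≠ p
  deg : ∀ v ∈ U, d ≤ #((JJ x y U).filter (H.Adj v))
  k4 : ∀ p ∈ U, ∀ q ∈ U, ∀ r ∈ U, ∀ s ∈ U, r ≠ s → H.Adj p q → H.Adj p r → H.Adj p s →
    H.Adj q r → H.Adj q s → False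

theorem card_fi {a : V} {s : Finset V} {P : V → Prop} :
    #((insert a s).filter P) ≤ (if P a then 1 else 0) + #(s.filter P) := by
  rw [Finset.filter_insert]
  split_ifs
  · have := Finset.card_insert_le a (s.filter P); omega
  · omega

section
variable {x y : V} {U : Finset V} {d : ℕ}

theorem St.degR (st : St H x y U d) {v : V} (hv : v ∈ U) (U' R : Finset V)
    (h : ∀ w ∈ JJ x y U, H.Adj v w → w ∈ U' ∨ w ∈ R) :
    d ≤ #(U'.filter (H.Adj v)) + #(R.filter (H.Adj v)) := by
  refine (st.deg v hv).trans (le_trans (Finset.card_le_card ?_) (Finset.card_union_le _ _))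
  intro w hw
  simp only [Finset.mem_filter, Finset.mem_union] at hw ⊢
  rcases h w hw.1 hw.2 with h' | h'
  · exact Or.inl ⟨h', hw.2⟩
  · exact Or.inr ⟨h', hw.2⟩

theorem St.deg2 (st : St H x y U d) {v : V} (hv : v ∈ U) (U' : Finset V) (p q : V)
    (h : ∀ w ∈ JJ x y U, H.Adj v w → w ∈ U' ∨ w = p ∨ w = q) :
    d ≤ #(U'.filter (H.Adj v)) + (if H.Adj v p then 1 else 0) + (if H.Adj v q then 1 else 0) := by
  have := st.degR hv U' (insert p (insert q ∅)) (by simpa using h)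
  have h1 := card_fi (a := p) (s := insert q ∅) (P := H.Adj v)
  have h2 := card_fi (a := q) (s := ∅) (P := H.Adj v)
  simp only [Finset.filter_empty, Finset.card_empty] at h2
  omega

theorem St.deg3 (st : St H x y U d) {v : V} (hv : v ∈ U) (U' : Finset V) (p q r : V)
    (h : ∀ w ∈ JJ x y U, H.Adj v w → w ∈ U' ∨ w = p ∨ w = q ∨ w = r) :
    d ≤ #(U'.filter (H.Adj v)) + (if H.Adj v p then 1 else 0) + (if H.Adj v q then 1 else 0) +
      (if H.Adj v r then 1 else 0) := by
  have := st.degR hv U' (insert p (insert q (insert r ∅))) (by simpa using h)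
  have h1 := card_fi (a := p) (s := insert q (insert r ∅)) (P := H.Adj v)
  have h2 := card_fi (a := q) (s := insert r ∅) (P := H.Adj v)
  have h3 := card_fi (a := r) (s := ∅) (P := H.Adj v)
  simp only [Finset.filter_empty, Finset.card_empty] at h3
  omega

theorem St.deg4 (st : St H x y U d) {v : V} (hv : v ∈ U) (U' : Finset V) (p q r s : V)
    (h : ∀ w ∈ JJ x y U, H.Adj v w → w ∈ U' ∨ w = p ∨ w = q ∨ w = r ∨ w = s) :
    d ≤ #(U'.filter (H.Adj v)) + (if H.Adj v p then 1 else 0) + (if H.Adj v q then 1 else 0) +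
      (if H.Adj v r then 1 else 0) + (if H.Adj v s then 1 else 0) := by
  have := st.degR hv U' (insert p (insert q (insert r (insert s ∅)))) (by simpa using h)
  have h1 := card_fi (a := p) (s := insert q (insert r (insert s ∅))) (P := H.Adj v)
  have h2 := card_fi (a := q) (s := insert r (insert s ∅)) (P := H.Adj v)
  have h3 := card_fi (a := r) (s := insert s ∅) (P := H.Adj v)
  have h4 := card_fi (a := s) (s := ∅) (P := H.Adj v)
  simp only [Finset.filter_empty, Finset.card_empty] at h4
  omega

def Fan (H : SimpleGraph V) (x y : V) (U : Finset V) (v : V) : Prop :=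
  ∃ S1 S2 n1 n2, EP H S1 x v n1 ∧ EP H S2 v y n2 ∧ S1 ⊆ JJ x y U ∧ S2 ⊆ JJ x y U ∧
    ∀ s ∈ S1, s ∈ S2 → s = v

/-- component of `U` containing `v` touches both roots -/
theorem St.compU (st : St H x y U d) {v : V} (hv : v ∈ U) :
    (∃ e ∈ comp H U v, H.Adj e x) ∧ (∃ e ∈ comp H U v, H.Adj e y) := by
  constructor
  · obtain ⟨e, he, w, hw, ha, hn, hp⟩ := st.conn2 (comp H U v) comp_sub ⟨v, comp_self hv⟩ y
    rcases mem_JJ.1 hw with rfl | rfl | h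
    · exact ⟨e, he, ha⟩
    · exact absurd rfl hp
    · exact absurd (comp_closed he h ha) hn
  · obtain ⟨e, he, w, hw, ha, hn, hp⟩ := st.conn2 (comp H U v) comp_sub ⟨v, comp_self hv⟩ x
    rcases mem_JJ.1 hw with rfl | rfl | h
    · exact absurd rfl hp
    · exact ⟨e, he, ha⟩
    · exact absurd (comp_closed he h ha) hn

theorem sub_JJ : U ⊆ JJ x y U := fun _ hw => mem_JJ.2 (Or.inr (Or.inr hw))
theorem x_JJ : x ∈ JJ x y U := by simp [JJ]
theorem y_JJ : y ∈ JJ x y U := by simp [JJ]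

theorem St.fan_x (st : St H x y U d) {v : V} (hv : v ∈ U) (hx : H.Adj v x) :
    Fan H x y U v := by
  obtain ⟨e, he, ha⟩ := (st.compU hv).2
  obtain ⟨S, n, hS, hp⟩ := comp_path (comp_self hv) he
  have h1 : EP H ({x} ∪ {v}) x v _ := (EP.nil x).app (EP.nil v) hx.symm (by
    simp; rintro rfl; exact st.hx hv)
  have h2 := hp.app (EP.nil y) ha (by
    intro s hs; simp; rintro rfl; exact st.hy (hS hs))
  refine ⟨_, _, _, _, h1, h2, ?_, ?_, ?_⟩
  · intro s; simp only [mem_union, mem_singleton]; rintro (rfl | rfl)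
    · exact x_JJ
    · exact sub_JJ hv
  · intro s; simp only [mem_union, mem_singleton]; rintro (h | rfl)
    · exact sub_JJ (hS h)
    · exact y_JJ
  · intro s; simp only [mem_union, mem_singleton]; rintro (rfl | rfl) (h | h)
    · exact absurd (hS h) st.hx
    · exact absurd h st.hxy
    · rfl
    · rfl

theorem St.fan_step (st : St H x y U d) {u v : V} (hu : u ∈ U) (hv : v ∈ U) (huv : H.Adj u v)
    (hf : Fan H x y U u) : Fan H x y U v := by
  obtain ⟨S1, S2, n1, n2, p1, p2, s1, s2, hd⟩ := hf
  have hne : u ≠ v := huv.ne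
  have hxu : x ≠ u := fun h => st.hx (h ▸ hu)
  have hyu : y ≠ u := fun h => st.hy (h ▸ hu)
  by_cases hv1 : v ∈ S1
  · obtain ⟨T1, T2, m1, m2, q1, q2, t1, t2, td⟩ := p1.split hv1
    refine ⟨T1, T2 ∪ S2, m1, _, q1, q2.join p2 (fun s hs => hd s (t2 hs)), t1.trans s1,
      union_subset (t2.trans s1) s2, ?_⟩
    intro s hs hs'
    rcases mem_union.1 hs' with h | h
    · exact td s hs h
    · have := hd s (t1 hs) h
      subst this
      exact td s hs q2.right
  by_cases hv2 : v ∈ S2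
  · obtain ⟨T1, T2, m1, m2, q1, q2, t1, t2, td⟩ := p2.split hv2
    refine ⟨S1 ∪ T1, T2, _, m2, p1.join q1 (fun s hs h => hd s hs (t1 h)), q2,
      union_subset s1 (t1.trans s2), t2.trans s2, ?_⟩
    intro s hs hs'
    rcases mem_union.1 hs with h | h
    · have := hd s h (t2 hs')
      subst this
      exact td s q1.left hs'
    · exact td s h hs'
  -- a path from v avoiding u to a root
  have hvK : v ∈ U.erase u := mem_erase.2 ⟨hne.symm, hv⟩
  have hroot : ∃ r S n, (r = x ∨ r = y) ∧ EP H S v r n ∧ S ⊆ JJ x y U ∧ u ∉ S := by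
    obtain ⟨e, he, w, hw, ha, hn, hp⟩ := st.conn2 (comp H (U.erase u) v)
      (comp_sub.trans (erase_subset _ _)) ⟨v, comp_self hvK⟩ u
    have hw' : w = x ∨ w = y := by
      rcases mem_JJ.1 hw with rfl | rfl | h
      · exact Or.inl rfl
      · exact Or.inr rfl
      · exact absurd (comp_closed he (mem_erase.2 ⟨hp, h⟩) ha) hn
    have hwU : w ∉ U := by rcases hw' with rfl | rfl; exacts [st.hx, st.hy]
    obtain ⟨S, n, hS, hq⟩ := comp_path (comp_self hvK) he
    refine ⟨w, _, _, hw', hq.app (EP.nil w) ha ?_, ?_, ?_⟩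
    · intro s hs; simp; rintro rfl; exact hwU (mem_of_mem_erase (hS hs))
    · intro s; simp only [mem_union, mem_singleton]; rintro (h | rfl)
      · exact sub_JJ (mem_of_mem_erase (hS h))
      · exact hw
    · simp only [mem_union, mem_singleton]; rintro (h | h)
      · exact (mem_erase.1 (hS h)).1 rfl
      · exact hp h.symm
  obtain ⟨r, S, n, hr, hp, hS, huS⟩ := hroot
  obtain ⟨z, T, m, hz, hq, hT, hTz⟩ := hp.firstHit (fun z => z ∈ S1 ∨ z ∈ S2) (by
    rcases hr with rfl | rfl
    · exact Or.inl p1.left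
    · exact Or.inr p2.right)
  have hzu : z ≠ u := fun h => huS (h ▸ hT hq.right)
  rcases hz with hz | hz
  · obtain ⟨T1, T2, m1, m2, q1, q2, t1, t2, td⟩ := p1.split hz
    have h1 := q1.join hq.rev (fun s hs h => hTz s h (Or.inl (t1 hs)))
    have h2 := (EP.nil v).app p2 huv.symm (by simpa using hv2)
    refine ⟨_, _, _, _, h1, h2, union_subset (t1.trans s1) (hT.trans hS),
      union_subset (by simpa using sub_JJ hv) s2, ?_⟩
    intro s hs hs'
    simp only [mem_union, mem_singleton] at hs hs'
    rcases hs' with h' | h'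
    · exact h'
    rcases hs with h | h
    · have := hd s (t1 h) h'
      subst this
      exact absurd (td s h q2.right).symm hzu
    · have := hTz s h (Or.inr h')
      subst this
      exact absurd (hd s hz h') hzu
  · obtain ⟨T1, T2, m1, m2, q1, q2, t1, t2, td⟩ := p2.split hz
    have h2 := hq.join q2 (fun s hs h => hTz s hs (Or.inr (t2 h)))
    have h1 := p1.app (EP.nil v) huv (by
      intro s hs; simp; rintro rfl; exact hv1 hs)
    refine ⟨_, _, _, _, h1, h2, union_subset s1 (by simpa using sub_JJ hv),
      union_subset (hT.trans hS) (t2.trans s2), ?_⟩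
    intro s hs' hs
    simp only [mem_union, mem_singleton] at hs hs'
    rcases hs' with h' | h'
    swap
    · exact h'
    rcases hs with h | h
    · have := hTz s h (Or.inl h')
      subst this
      exact absurd (hd s h' hz) hzu
    · have := hd s h' (t2 h)
      subst this
      exact absurd (td s q1.left h).symm hzu

theorem St.fan (st : St H x y U d) {v : V} (hv : v ∈ U) : Fan H x y U v := by
  obtain ⟨e, he, ha⟩ := (st.compU hv).1
  obtain ⟨S, n, hS, hp⟩ := comp_path he (comp_self hv)
  have := hp.closed U hS (fun v => v ∈ U ∧ Fan H x y U v)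
    (fun e h w hw ha => ⟨hw, st.fan_step h.1 hw ha h.2⟩)
    ⟨comp_sub he, st.fan_x (comp_sub he) ha⟩
  exact this.2

theorem St.link (st : St H x y U d) {D : Finset V} (hD : D ⊆ U) (hne : D.Nonempty) :
    ∃ w w' S1 S2 n1 n2, (∃ e ∈ D, H.Adj e w) ∧ (∃ e ∈ D, H.Adj e w') ∧
      EP H S1 x w n1 ∧ EP H S2 w' y n2 ∧ S1 ⊆ JJ x y U ∧ S2 ⊆ JJ x y U ∧
      (∀ s ∈ S1, s ∉ S2) ∧ (∀ s ∈ S1, s ∉ D) ∧ (∀ s ∈ S2, s ∉ D) ∧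
      (∀ s ∈ S1, (∃ e ∈ D, H.Adj e s) → s = w) ∧
      (∀ s ∈ S2, (∃ e ∈ D, H.Adj e s) → s = w') := by
  obtain ⟨v, hv⟩ := hne
  obtain ⟨S1, S2, n1, n2, p1, p2, s1, s2, hd⟩ := st.fan (hD hv)
  obtain ⟨w, T1, m1, a1, q1, t1, d1, f1⟩ := p1.cross D (fun h => st.hx (hD h)) hv
  obtain ⟨w', T2, m2, a2, q2, t2, d2, f2⟩ := p2.rev.cross D (fun h => st.hy (hD h)) hv
  refine ⟨w, w', T1, T2, m1, m2, a1, a2, q1, q2.rev, t1.trans s1, t2.trans s2, ?_, d1, d2, f1, f2⟩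
  intro s hs hs'
  have := hd s (t1 hs) (t2 hs')
  subst this
  exact d1 s hs hv

theorem St.path (st : St H x y U d) : ∃ n, LL H (JJ x y U) x y n := by
  obtain ⟨v, hv⟩ := st.ne
  obtain ⟨S1, S2, n1, n2, p1, p2, s1, s2, hd⟩ := st.fan hv
  exact ⟨_, _, union_subset s1 s2, p1.join p2 hd⟩

theorem St.F1 (st : St H x y U d) (ih : IHh H U) {D : Finset V} (hD : D ⊂ U) (hne : D.Nonempty)
    (p q : V) (hN : ∀ e ∈ D, ∀ w ∈ JJ x y U, H.Adj e w → w ∈ D ∨ w = p ∨ w = q) :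
    Span (LL H (JJ x y U) x y) (d - 2) := by
  obtain ⟨w, w', S1, S2, n1, n2, ⟨e1, he1, ha1⟩, ⟨e2, he2, ha2⟩, p1, p2, s1, s2, hd, hd1, hd2,
    f1, f2⟩ := st.link hD.1 hne
  have hww : w ≠ w' := fun h => hd w p1.right (h ▸ p2.left)
  have hw : w = p ∨ w = q :=
    (hN e1 he1 w (s1 p1.right) ha1).resolve_left (hd1 w p1.right)
  have hw' : w' = p ∨ w' = q :=
    (hN e2 he2 w' (s2 p2.left) ha2).resolve_left (hd2 w' p2.left)
  have hN' : ∀ e ∈ D, ∀ z ∈ JJ x y U, H.Adj e z → z ∈ D ∨ z = w ∨ z = w' := by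
    intro e he z hz ha
    rcases hN e he z hz ha with h | h | h
    · exact Or.inl h
    · grind
    · grind
  refine (ih D (fun v => H.Adj v w) (fun v => H.Adj v w') d hD hne ?_ ?_ ?_).shift (c := n1 + n2 + 2) ?_
  · intro v hv
    exact st.deg2 (hD.1 hv) D w w' (hN' v hv)
  · intro E hE hEn hc
    constructor
    · obtain ⟨e, he, z, hz, ha, hn, hp⟩ := st.conn2 E (hE.trans hD.1) hEn w'
      rcases hN' e (hE he) z hz ha with h | h | h
      · exact absurd (hc e he z h ha) hn
      · exact ⟨e, he, h ▸ ha⟩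
      · exact absurd h hp
    · obtain ⟨e, he, z, hz, ha, hn, hp⟩ := st.conn2 E (hE.trans hD.1) hEn w
      rcases hN' e (hE he) z hz ha with h | h | h
      · exact absurd (hc e he z h ha) hn
      · exact absurd h hp
      · exact ⟨e, he, h ▸ ha⟩
  · intro E hE hEn c hcU hcE hc
    obtain ⟨e, he, z, hz, ha, hn, hp⟩ := st.conn2 E (hE.trans hD.1) hEn c
    rcases hN' e (hE he) z hz ha with h | h | h
    · exact absurd (hc e he z h ha) (by tauto)
    · exact ⟨e, he, Or.inl (h ▸ ha)⟩
    · exact ⟨e, he, Or.inr (h ▸ ha)⟩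
  · rintro m ⟨S, u, u', hS, hu, hu', hp⟩
    have := (p1.app hp hu.symm (fun s hs h => hd1 s hs (hS h))).app p2 hu' (by
      intro s hs h
      rcases mem_union.1 hs with h' | h'
      · exact hd s h' h
      · exact hd2 s h (hS h'))
    refine ⟨_, union_subset (union_subset s1 ((hS.trans hD.1).trans sub_JJ)) s2, ?_⟩
    convert this using 1
    omega

end
end CL

namespace CL
open scoped Classical
open Finset
variable {V : Type*} {H : SimpleGraph V}
section
variable {x y : V} {U : Finset V} {d : ℕ}

structure Bad (H : SimpleGraph V) (x y : V) (U : Finset V) (d : ℕ) : Prop extends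
    St H x y U d where
  ih : IHh H U
  no : ¬ Span (LL H (JJ x y U) x y) (d - 2)

theorem Bad.d3 (b : Bad H x y U d) : 3 ≤ d := by
  by_contra h
  obtain ⟨n, hn⟩ := b.path
  exact b.no ((span0 hn).mono (by omega))

theorem Bad.c3 (b : Bad H x y U d) {E : Finset V} (hE : E ⊂ U) (hne : E.Nonempty) (p q : V) :
    ∃ e ∈ E, ∃ w ∈ JJ x y U, H.Adj e w ∧ w ∉ E ∧ w ≠ p ∧ w ≠ q := by
  by_contra h
  refine b.no (b.F1 b.ih hE hne p q ?_)
  intro e he w hw ha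
  by_contra h'
  push Not at h'
  exact h ⟨e, he, w, hw, ha, h'⟩

/-- Edges `x - v`. -/
theorem ep1 {u v : V} (h : H.Adj u v) : EP H ({u} ∪ {v}) u v 1 :=
  (EP.nil u).app (EP.nil v) h (by simpa using h.ne)

theorem Bad.case1c (b : Bad H x y U d)
    (h1 : ∀ v ∈ U, ∀ a ∈ U, ∀ a' ∈ U, H.Adj x a → H.Adj x a' → H.Adj v a → H.Adj v a' → a = a')
    (hA : ∀ v ∈ U, H.Adj x v) : False := by
  have hd := b.d3
  obtain ⟨v, hv⟩ := b.ne
  have hu : ∃ u ∈ U, H.Adj v u := by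
    by_contra h
    push Not at h
    have := b.deg2 hv ∅ x y (by
      intro w hw ha
      rcases mem_JJ.1 hw with h' | h' | h'
      · tauto
      · tauto
      · exact absurd ha (h w h'))
    simp only [Finset.filter_empty, Finset.card_empty] at this
    split_ifs at this <;> omega
  obtain ⟨u, hu, hvu⟩ := hu
  have key : ∀ v ∈ U, ∀ u ∈ U, H.Adj v u → d = 3 ∧ H.Adj v y := by
    intro v hv u hu hvu
    have := b.deg3 hv ∅ x y u (by
      intro w hw ha
      rcases mem_JJ.1 hw with h' | h' | h'
      · tauto
      · tauto
      · have := h1 v hv w h' u hu (hA w h') (hA u hu) ha hvu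
        tauto)
    simp only [Finset.filter_empty, Finset.card_empty] at this
    split_ifs at this
    all_goals first | omega | skip
    all_goals refine ⟨by omega, by assumption⟩
  obtain ⟨hd3, hvy⟩ := key v hv u hu hvu
  obtain ⟨_, huy⟩ := key u hu v hv hvu.symm
  have hxv : x ≠ v := fun h => b.hx (h ▸ hv)
  have hxu : x ≠ u := fun h => b.hx (h ▸ hu)
  have hyv : y ≠ v := fun h => b.hy (h ▸ hv)
  have hyu : y ≠ u := fun h => b.hy (h ▸ hu)
  have hxy := b.hxy
  refine b.no ((span1 (p := 2) ?_ ?_).mono (by omega))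
  · refine ⟨_, ?_, (ep1 (hA v hv)).app (EP.nil y) hvy ?_⟩
    · intro s; simp [mem_JJ]; rintro (rfl | rfl | rfl) <;> tauto
    · simp; tauto
  · refine ⟨_, ?_, ((ep1 (hA v hv)).app (EP.nil u) hvu ?_).app (EP.nil y) huy ?_⟩
    · intro s; simp [mem_JJ]; rintro (rfl | rfl | rfl | rfl) <;> tauto
    · simp; exact ⟨hxu, hvu.ne⟩
    · simp; tauto

theorem Bad.case1 (b : Bad H x y U d)
    (h1 : ∀ v ∈ U, ∀ a ∈ U, ∀ a' ∈ U, H.Adj x a → H.Adj x a' → H.Adj v a → H.Adj v a' → a = a') :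
    False := by
  by_cases hA : ∀ v ∈ U, H.Adj x v
  · exact b.case1c h1 hA
  push Not at hA
  obtain ⟨v, hv, hxv⟩ := hA
  have hvK : v ∈ U.filter (fun w => ¬ H.Adj x w) := mem_filter.2 ⟨hv, hxv⟩
  set D := comp H (U.filter (fun w => ¬ H.Adj x w)) v with hDdef
  have hDU : ∀ e ∈ D, e ∈ U := fun e he => (mem_filter.1 (comp_sub he)).1
  have hDx : ∀ e ∈ D, ¬ H.Adj x e := fun e he => (mem_filter.1 (comp_sub he)).2
  have hDne : D.Nonempty := ⟨v, comp_self hvK⟩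
  have hDN : ∀ e ∈ D, ∀ w ∈ JJ x y U, H.Adj e w → w ∈ D ∨ w = y ∨ (w ∈ U ∧ H.Adj x w) := by
    intro e he w hw ha
    rcases mem_JJ.1 hw with rfl | rfl | h
    · exact absurd ha.symm (hDx e he)
    · tauto
    · by_cases hx : H.Adj x w
      · tauto
      · exact Or.inl (comp_closed he (mem_filter.2 ⟨h, hx⟩) ha)
  have hDss : D ⊂ U := by
    refine ⟨hDU, fun h => ?_⟩
    obtain ⟨e, he, ha⟩ := (b.compU hv).1
    exact hDx e (h (comp_sub he)) ha.symm
  by_cases hy : ∃ e ∈ D, H.Adj e y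
  · refine b.no ((b.ih.comp hvK (fun u => ∃ a ∈ U, H.Adj x a ∧ H.Adj u a) (fun u => H.Adj u y) d
      hDss ?_ ?_ hy ?_).shift (c := 3) ?_)
    · intro u hu
      by_cases hua : ∃ a ∈ U, H.Adj x a ∧ H.Adj u a
      · rw [if_pos hua]
        obtain ⟨a, ha, hxa, hua⟩ := hua
        have := b.deg2 (hDU u hu) D a y (by
          intro w hw hadj
          rcases hDN u hu w hw hadj with h | h | ⟨h, h'⟩
          · tauto
          · tauto
          · exact Or.inr (Or.inl (h1 u (hDU u hu) w h a ha h' hxa hadj hua)))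
        rw [if_pos hua] at this
        exact this
      · rw [if_neg hua]
        have := b.deg2 (hDU u hu) D x y (by
          intro w hw hadj
          rcases hDN u hu w hw hadj with h | h | ⟨h, h'⟩
          · tauto
          · tauto
          · exact absurd ⟨w, h, h', hadj⟩ hua)
        rw [if_neg (fun h => hDx u hu h.symm)] at this
        exact this
    · obtain ⟨e, he, w, hw, ha, hn, hp⟩ := b.conn2 D hDss.1 hDne y
      rcases hDN e he w hw ha with h | h | ⟨h, h'⟩
      · exact absurd h hn
      · exact absurd h hp
      · exact ⟨e, he, w, h, h', ha⟩
    · intro E hE hEn c hcU hcE hc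
      obtain ⟨e, he, w, hw, ha, hn, hp⟩ := b.conn2 E (hE.trans hDss.1) hEn c
      rcases hDN e (hE he) w hw ha with h | h | ⟨h, h'⟩
      · exact absurd (hc e he w h ha) (by tauto)
      · exact ⟨e, he, Or.inr (h ▸ ha)⟩
      · exact ⟨e, he, Or.inl ⟨w, h, h', ha⟩⟩
    · rintro m ⟨S, u, u', hS, ⟨a, haU, hxa, hua⟩, hu', hp⟩
      have := ((ep1 hxa).app hp hua.symm (by
        simp only [mem_union, mem_singleton]
        rintro s (rfl | rfl) hs
        · exact b.hx (hDU _ (hS hs))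
        · exact hDx _ (hS hs) hxa)).app (EP.nil y) hu' (by
        simp only [mem_union, mem_singleton]
        rintro s ((rfl | rfl) | hs) rfl
        · exact b.hxy rfl
        · exact b.hy haU
        · exact b.hy (hDU _ (hS hs)))
      refine ⟨_, ?_, by convert this using 1; omega⟩
      intro s
      simp only [mem_union, mem_singleton, mem_JJ]
      rintro (((rfl | rfl) | hs) | rfl)
      · tauto
      · tauto
      · have := hDU _ (hS hs); tauto
      · tauto
  · push Not at hy
    obtain ⟨w, a1, S1, S2, n1, n2, -, ⟨e2, he2, ha2⟩, p1, p2, s1, s2, hd, hd1, hd2, f1, f2⟩ :=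
      b.link hDss.1 hDne
    have hDN' : ∀ e ∈ D, ∀ w ∈ JJ x y U, H.Adj e w → w ∈ D ∨ (w ∈ U ∧ H.Adj x w) := by
      intro e he w hw ha
      rcases hDN e he w hw ha with h | rfl | h
      · tauto
      · exact absurd ha (hy e he)
      · tauto
    have ha1 : a1 ∈ U ∧ H.Adj x a1 :=
      (hDN' e2 he2 a1 (s2 p2.left) ha2).resolve_left (hd2 a1 p2.left)
    refine b.no ((b.ih.comp hvK (fun u => ∃ a ∈ U, a ≠ a1 ∧ H.Adj x a ∧ H.Adj u a)
      (fun u => H.Adj u a1) d hDss ?_ ?_ ⟨e2, he2, ha2⟩ ?_).shift (c := n2 + 3) ?_)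
    · intro u hu
      have hxu : ¬ H.Adj u x := fun h => hDx u hu h.symm
      by_cases hua : ∃ a ∈ U, H.Adj x a ∧ H.Adj u a
      · obtain ⟨a, ha, hxa, hua⟩ := hua
        have := b.deg2 (hDU u hu) D a x (by
          intro w hw hadj
          rcases hDN' u hu w hw hadj with h | ⟨h, h'⟩
          · tauto
          · exact Or.inr (Or.inl (h1 u (hDU u hu) w h a ha h' hxa hadj hua)))
        rw [if_pos hua, if_neg hxu] at this
        by_cases haa : a = a1
        · rw [if_pos (show H.Adj u a1 from haa ▸ hua)]
          exact this.trans (by rw [add_zero]; gcongr; exact Nat.le_add_right _ _)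
        · rw [if_pos (show ∃ a ∈ U, a ≠ a1 ∧ H.Adj x a ∧ H.Adj u a from ⟨a, ha, haa, hxa, hua⟩)]
          exact this.trans (Nat.add_le_add_left (Nat.zero_le _) _)
      · have := b.deg2 (hDU u hu) D x y (by
          intro w hw hadj
          rcases hDN' u hu w hw hadj with h | ⟨h, h'⟩
          · tauto
          · exact absurd ⟨w, h, h', hadj⟩ hua)
        rw [if_neg hxu, if_neg (hy u hu)] at this
        exact this.trans (by rw [add_assoc, add_assoc]; exact Nat.add_le_add_left (Nat.zero_le _) _)
    · obtain ⟨e, he, w, hw, ha, hn, hp⟩ := b.conn2 D hDss.1 hDne a1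
      rcases hDN' e he w hw ha with h | ⟨h, h'⟩
      · exact absurd h hn
      · exact ⟨e, he, w, h, hp, h', ha⟩
    · intro E hE hEn c hcU hcE hc
      obtain ⟨e, he, w, hw, ha, hn, hp⟩ := b.conn2 E (hE.trans hDss.1) hEn c
      rcases hDN' e (hE he) w hw ha with h | ⟨h, h'⟩
      · exact absurd (hc e he w h ha) (by tauto)
      · refine ⟨e, he, ?_⟩
        by_cases hw1 : w = a1
        · exact Or.inr (hw1 ▸ ha)
        · exact Or.inl ⟨w, h, hw1, h', ha⟩
    · rintro m ⟨S, u, u', hS, ⟨a, haU, haa, hxa, hua⟩, hu', hp⟩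
      have := ((ep1 hxa).app hp hua.symm (by
        simp only [mem_union, mem_singleton]
        rintro s (rfl | rfl) hs
        · exact b.hx (hDU _ (hS hs))
        · exact hDx _ (hS hs) hxa)).app p2 hu' (by
        simp only [mem_union, mem_singleton]
        rintro s ((rfl | rfl) | hs) hs'
        · exact hd _ p1.left hs'
        · exact haa (f2 _ hs' ⟨u, hS hp.left, hua⟩)
        · exact hd2 _ hs' (hS hs))
      refine ⟨_, ?_, by convert this using 1; omega⟩
      refine union_subset (union_subset ?_ ((hS.trans hDss.1).trans sub_JJ)) s2
      intro s
      simp only [mem_union, mem_singleton, mem_JJ]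
      rintro (rfl | rfl) <;> tauto
end
end CL

namespace CL
open scoped Classical
open Finset
variable {V : Type*} {H : SimpleGraph V}
section
variable {x y : V} {U : Finset V} {d : ℕ}

theorem Bad.ih3 (b : Bad H x y U d) {D : Finset V} (hD : D ⊂ U) (hne : D.Nonempty) (p q r : V)
    (hN : ∀ e ∈ D, ∀ w ∈ JJ x y U, H.Adj e w → w ∈ D ∨ w = p ∨ w = q ∨ w = r) :
    Span (LAB H D (fun u => H.Adj u p) (fun u => H.Adj u q)) (d - 1 - 2) := by
  refine b.ih D _ _ (d - 1) hD hne ?_ ?_ ?_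
  · intro v hv
    have := b.deg3 (hD.1 hv) D p q r (hN v hv)
    have h' : (if H.Adj v r then 1 else 0) ≤ 1 := by split_ifs <;> omega
    omega
  · intro E hE hEn hc
    have hEU : E ⊂ U := lt_of_le_of_lt hE hD
    constructor
    · obtain ⟨e, he, w, hw, ha, hn, h1, h2⟩ := b.c3 hEU hEn q r
      rcases hN e (hE he) w hw ha with h | rfl | h | h
      · exact absurd (hc e he w h ha) hn
      · exact ⟨e, he, ha⟩
      · exact absurd h h1
      · exact absurd h h2
    · obtain ⟨e, he, w, hw, ha, hn, h1, h2⟩ := b.c3 hEU hEn p r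
      rcases hN e (hE he) w hw ha with h | h | rfl | h
      · exact absurd (hc e he w h ha) hn
      · exact absurd h h1
      · exact ⟨e, he, ha⟩
      · exact absurd h h2
  · intro E hE hEn c hcU hcE hc
    have hEU : E ⊂ U := lt_of_le_of_lt hE hD
    obtain ⟨e, he, w, hw, ha, hn, h1, h2⟩ := b.c3 hEU hEn c r
    rcases hN e (hE he) w hw ha with h | rfl | rfl | h
    · exact absurd (hc e he w h ha) (by tauto)
    · exact ⟨e, he, Or.inl ha⟩
    · exact ⟨e, he, Or.inr ha⟩
    · exact absurd h h2

theorem Bad.glue (b : Bad H x y U d) {D1 D2 SQ : Finset V} {w z : V} {nQ r1 r2 : ℕ}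
    (h1 : Span (LAB H D1 (fun u => H.Adj u x) (fun u => H.Adj u w)) r1)
    (h2 : Span (LAB H D2 (fun u => H.Adj u w) (fun u => H.Adj u z)) r2)
    (hD1 : D1 ⊆ U) (hD2 : D2 ⊆ U) (hw : w ∈ U) (hQ : EP H SQ z y nQ) (hSQ : SQ ⊆ JJ x y U)
    (hxQ : x ∉ SQ) (hw1 : w ∉ D1) (hw2 : w ∉ D2) (hwQ : w ∉ SQ) (h12 : ∀ s ∈ D1, s ∉ D2)
    (h1Q : ∀ s ∈ D1, s ∉ SQ) (h2Q : ∀ s ∈ D2, s ∉ SQ) (hr : d - 2 ≤ r1 + r2) : False := by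
  have hxw : x ≠ w := fun h => b.hx (h ▸ hw)
  refine b.no (h1.add h2 (c := nQ + 4) ?_ hr)
  rintro m1 m2 ⟨S1, u1, v1, hS1, hu1, hv1, p1⟩ ⟨S2, u2, v2, hS2, hu2, hv2, p2⟩
  have hp := ((((EP.nil x).app p1 hu1.symm (by
    simp only [mem_singleton]
    rintro s rfl h; exact b.hx (hD1 (hS1 h)))).app (EP.nil w) hv1 (by
    simp only [mem_union, mem_singleton]
    rintro s (rfl | h) rfl
    · exact hxw rfl
    · exact hw1 (hS1 h))).app p2 hu2.symm (by
    simp only [mem_union, mem_singleton]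
    rintro s ((rfl | h) | rfl) h'
    · exact b.hx (hD2 (hS2 h'))
    · exact h12 s (hS1 h) (hS2 h')
    · exact hw2 (hS2 h'))).app hQ hv2 (by
    simp only [mem_union, mem_singleton]
    rintro s (((rfl | h) | rfl) | h) h'
    · exact hxQ h'
    · exact h1Q s (hS1 h) h'
    · exact hwQ h'
    · exact h2Q s (hS2 h) h')
  refine ⟨_, ?_, by convert hp using 1; omega⟩
  refine union_subset (union_subset (union_subset (union_subset ?_ ?_) ?_) ?_) hSQ
  · simpa using x_JJ
  · exact (hS1.trans hD1).trans sub_JJ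
  · simpa using sub_JJ hw
  · exact (hS2.trans hD2).trans sub_JJ

theorem Bad.F2a (b : Bad H x y U d) (hd : 4 ≤ d) {D : Finset V} (hD : D ⊆ U) (hne : D.Nonempty)
    {w o : V} (hw : w ∈ U) (hwD : w ∉ D) (ho : o ∈ U) (hoD : o ∉ D) (how : o ≠ w)
    (hN : ∀ e ∈ D, ∀ z ∈ JJ x y U, H.Adj e z → z ∈ D ∨ z = x ∨ z = w ∨ z = y) : False := by
  set O := (U \ D).erase w with hO
  have hOm : ∀ s, s ∈ O ↔ s ≠ w ∧ s ∈ U ∧ s ∉ D := by intro s; simp [hO]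
  have hOU : O ⊆ U := fun s hs => ((hOm s).1 hs).2.1
  have hNO : ∀ e ∈ O, ∀ z ∈ JJ x y U, H.Adj e z → z ∈ O ∨ z = x ∨ z = w ∨ z = y := by
    intro e he z hz ha
    obtain ⟨e1, e2, e3⟩ := (hOm e).1 he
    have hzD : z ∉ D := by
      intro h
      rcases hN z h e (sub_JJ e2) ha.symm with h | rfl | h | rfl
      · exact e3 h
      · exact b.hx e2
      · exact e1 h
      · exact b.hy e2
    rw [hOm]
    rcases mem_JJ.1 hz with h | h | h <;> tauto
  refine b.glue (D1 := O) (D2 := D) (w := w) (z := y) (b.ih3 ?_ ⟨o, ?_⟩ x w y hNO)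
    (b.ih3 ?_ hne w y x ?_) hOU hD hw (EP.nil y) ?_ ?_ ?_ hwD ?_ ?_ ?_ ?_ ?_
  · exact ⟨hOU, fun h => ((hOm w).1 (h hw)).1 rfl⟩
  · exact (hOm o).2 ⟨how, ho, hoD⟩
  · exact ⟨hD, fun h => hwD (h hw)⟩
  · intro e he z hz ha
    have := hN e he z hz ha
    tauto
  · simpa using y_JJ
  · simpa using b.hxy
  · exact fun h => ((hOm w).1 h).1 rfl
  · simp only [mem_singleton]; rintro rfl; exact b.hy hw
  · exact fun s hs => ((hOm s).1 hs).2.2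
  · intro s hs; simp only [mem_singleton]; rintro rfl; exact b.hy (hOU hs)
  · intro s hs; simp only [mem_singleton]; rintro rfl; exact b.hy (hD hs)
  · omega

set_option maxHeartbeats 4000000 in
theorem Bad.F2b (b : Bad H x y U d) (hd : 5 ≤ d) {D : Finset V} (hD : D ⊆ U) (hne : D.Nonempty)
    {w2 w3 o : V} (hw2 : w2 ∈ U) (hw2D : w2 ∉ D) (hw3 : w3 ∈ U) (hw3D : w3 ∉ D) (hw : w2 ≠ w3)
    (ho : o ∈ U) (hoD : o ∉ D) (how : o ≠ w2) (how' : o ≠ w3)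
    (hN : ∀ e ∈ D, ∀ z ∈ JJ x y U, H.Adj e z → z ∈ D ∨ z = x ∨ z = w2 ∨ z = w3) : False := by
  have hDss : D ⊂ U := ⟨hD, fun h => hw2D (h hw2)⟩
  have hxw2 : x ≠ w2 := fun h => b.hx (h ▸ hw2)
  have hxw3 : x ≠ w3 := fun h => b.hx (h ▸ hw3)
  have hyw2 : y ≠ w2 := fun h => b.hy (h ▸ hw2)
  have hyw3 : y ≠ w3 := fun h => b.hy (h ▸ hw3)
  have hxy := b.hxy
  set O := ((U \ D).erase w2).erase w3 with hO
  have hOm : ∀ s, s ∈ O ↔ s ≠ w3 ∧ s ≠ w2 ∧ s ∈ U ∧ s ∉ D := by intro s; simp [hO]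
  have hOU : O ⊆ U := fun s hs => ((hOm s).1 hs).2.2.1
  have hOss : O ⊂ U := ⟨hOU, fun h => ((hOm w3).1 (h hw3)).1 rfl⟩
  have hOD : ∀ e ∈ O, ∀ z ∈ D, ¬ H.Adj e z := by
    intro e he z hz ha
    obtain ⟨e1, e2, e3, e4⟩ := (hOm e).1 he
    rcases hN z hz e (sub_JJ e3) ha.symm with h | rfl | h | h
    · exact e4 h
    · exact b.hx e3
    · exact e2 h
    · exact e1 h
  have hNO : ∀ e ∈ O, ∀ z ∈ JJ x y U, H.Adj e z → z ∈ O ∨ z = x ∨ z = y ∨ z = w2 ∨ z = w3 := by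
    intro e he z hz ha
    have hzD : z ∉ D := fun h => hOD e he z h ha
    rw [hOm]
    rcases mem_JJ.1 hz with h | h | h <;> grind
  by_cases hb1 : ∃ E ⊆ O, E.Nonempty ∧ ∃ c ∈ JJ x y U,
      ∀ e ∈ E, ∀ z ∈ JJ x y U, H.Adj e z → z ∈ E ∨ z = x ∨ z = c ∨ z = w3
  · obtain ⟨E, hE, hEne, c, hc, hNE⟩ := hb1
    have hEss : E ⊂ U := lt_of_le_of_lt hE hOss
    obtain ⟨e, he, z, hz, ha, hn, h1, h2⟩ := b.c3 hEss hEne x w3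
    have hzc : z = c := by
      rcases hNE e he z hz ha with h | h | h | h
      · exact absurd h hn
      · exact absurd h h1
      · exact h
      · exact absurd h h2
    subst hzc
    have hzD : z ∉ D := fun h => hOD e (hE he) z h ha
    have hw3E : w3 ∉ E := fun h => ((hOm _).1 (hE h)).1 rfl
    have hED : ∀ s ∈ D, s ∉ E := fun s hs h => ((hOm _).1 (hE h)).2.2.2 hs
    have hQ : ∃ SQ nQ, EP H SQ z y nQ ∧ SQ ⊆ JJ x y U ∧
        ∀ s ∈ SQ, s ≠ x ∧ s ≠ w3 ∧ s ∉ D ∧ s ∉ E := by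
      rcases mem_JJ.1 hz with h | h | hzU
      · exact absurd h h1
      · subst h
        refine ⟨_, _, EP.nil _, by simpa using hz, ?_⟩
        simp only [mem_singleton]
        rintro s rfl
        grind
      set K := ((U \ D) \ E).erase w3 with hK
      have hKm : ∀ s, s ∈ K ↔ s ≠ w3 ∧ s ∈ U ∧ s ∉ D ∧ s ∉ E := by
        intro s; simp [hK]; grind
      have hzK : z ∈ K := (hKm z).2 ⟨h2, hzU, hzD, hn⟩
      by_cases hF : ∃ f ∈ comp H K z, H.Adj f y
      · obtain ⟨f, hf, hfy⟩ := hF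
        obtain ⟨S, n, hS, hp⟩ := comp_path (comp_self hzK) hf
        refine ⟨_, _, hp.app (EP.nil y) hfy ?_, ?_, ?_⟩
        · intro s hs; simp only [mem_singleton]; rintro rfl; exact b.hy ((hKm _).1 (hS hs)).2.1
        · intro s
          simp only [mem_union, mem_singleton]
          rintro (h | rfl)
          · exact sub_JJ ((hKm _).1 (hS h)).2.1
          · exact y_JJ
        · intro s
          simp only [mem_union, mem_singleton]
          rintro (h | rfl)
          · obtain ⟨k1, k2, k3, k4⟩ := (hKm _).1 (hS h)
            exact ⟨fun h => b.hx (h ▸ k2), k1, k3, k4⟩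
          · exact ⟨hxy.symm, hyw3, fun h => b.hy (hD h), fun h => b.hy (hEss.1 h)⟩
      · exfalso
        push Not at hF
        have hzF : z ∈ comp H K z := comp_self hzK
        have hFN : ∀ e ∈ comp H K z, ∀ w ∈ JJ x y U, H.Adj e w →
            w ∈ comp H K z ∨ (e = w2 ∧ w ∈ D) ∨ w ∈ E ∨ w = x ∨ w = w3 := by
          intro f hf w hw hfw
          rcases mem_JJ.1 hw with rfl | rfl | hwU
          · grind
          · exact absurd hfw (hF f hf)
          · by_cases hwK : w ∈ K
            · exact Or.inl (comp_closed hf hwK hfw)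
            · rw [hKm] at hwK
              by_cases hwD : w ∈ D
              · obtain ⟨k1, k2, k3, k4⟩ := (hKm _).1 (comp_sub hf)
                rcases hN w hwD f (sub_JJ k2) hfw.symm with h | h | h | h
                · exact absurd h k3
                · exact absurd (h ▸ k2) b.hx
                · grind
                · exact absurd h k1
              · grind
        have hw3F : w3 ∉ comp H K z := fun h => ((hKm _).1 (comp_sub h)).1 rfl
        have hFU : comp H K z ⊆ U := fun s hs => ((hKm _).1 (comp_sub hs)).2.1
        by_cases hw2F : w2 ∈ comp H K z
        · obtain ⟨f, hf, w, hw, hfw, hn', h1', h2'⟩ := b.c3 (E := comp H K z ∪ E ∪ D)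
            ⟨union_subset (union_subset hFU hEss.1) hD, fun h => by
              have := h hw3; simp only [mem_union] at this; tauto⟩ ⟨z, by simp [hzF]⟩ x w3
          simp only [mem_union] at hf hn'
          rcases hf with (hf | hf) | hf
          · have := hFN f hf w hw hfw; grind
          · rcases hNE f hf w hw hfw with h | h | h | h
            · grind
            · grind
            · subst h; grind
            · grind
          · rcases hN f hf w hw hfw with h | h | h | h
            · grind
            · grind
            · subst h; grind
            · grind
        · obtain ⟨f, hf, w, hw, hfw, hn', h1', h2'⟩ := b.c3 (E := comp H K z ∪ E)
            ⟨(union_subset hFU hEss.1), fun h => by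
              have := h hw3; simp only [mem_union] at this; tauto⟩ ⟨z, by simp [hzF]⟩ x w3
          simp only [mem_union] at hf hn'
          rcases hf with hf | hf
          · rcases hFN f hf w hw hfw with h | ⟨rfl, h⟩ | h
            · grind
            · grind
            · grind
          · rcases hNE f hf w hw hfw with h | h | h | h
            · grind
            · grind
            · subst h; grind
            · grind
    obtain ⟨SQ, nQ, hQ, hSQ, hQd⟩ := hQ
    refine b.glue (D1 := D) (D2 := E) (w := w3) (z := z) (b.ih3 hDss hne x w3 w2 ?_)
      (b.ih3 hEss hEne w3 z x ?_) hD hEss.1 hw3 hQ hSQ (fun h => (hQd x h).1 rfl) hw3D hw3E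
      (fun h => (hQd w3 h).2.1 rfl) hED ?_ ?_ (by omega)
    · intro e he z hz ha
      have := hN e he z hz ha; grind
    · intro e he z hz ha
      have := hNE e he z hz ha; grind
    · exact fun s hs h => (hQd s h).2.2.1 hs
    · exact fun s hs h => (hQd s h).2.2.2 hs
  · push Not at hb1
    have hb2 : ∀ E ⊆ O, E.Nonempty → ∀ c ∈ JJ x y U, ∃ e ∈ E, ∃ z ∈ JJ x y U, H.Adj e z ∧
        z ∉ E ∧ z ≠ x ∧ z ≠ c ∧ z ≠ w3 := hb1
    have hoO : o ∈ O := (hOm o).2 ⟨how', how, ho, hoD⟩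
    have hs : Span (LAB H O (fun u => H.Adj u w2) (fun u => H.Adj u y)) (3 - 2) := by
      refine b.ih O _ _ 3 hOss ⟨o, hoO⟩ ?_ ?_ ?_
      · intro v hv
        have := b.deg4 (hOU hv) O x y w2 w3 (hNO v hv)
        have h' : (if H.Adj v x then 1 else 0) ≤ 1 := by split_ifs <;> omega
        have h'' : (if H.Adj v w3 then 1 else 0) ≤ 1 := by split_ifs <;> omega
        omega
      · intro E hE hEn hc
        constructor
        · obtain ⟨e, he, z, hz, ha, k1, k2, k3, k4⟩ := hb2 E hE hEn y y_JJ
          rcases hNO e (hE he) z hz ha with h | h | h | rfl | h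
          · exact absurd (hc e he z h ha) k1
          · exact absurd h k2
          · exact absurd h k3
          · exact ⟨e, he, ha⟩
          · exact absurd h k4
        · obtain ⟨e, he, z, hz, ha, k1, k2, k3, k4⟩ := hb2 E hE hEn w2 (sub_JJ hw2)
          rcases hNO e (hE he) z hz ha with h | h | rfl | h | h
          · exact absurd (hc e he z h ha) k1
          · exact absurd h k2
          · exact ⟨e, he, ha⟩
          · exact absurd h k3
          · exact absurd h k4
      · intro E hE hEn c hcU hcE hc
        obtain ⟨e, he, z, hz, ha, k1, k2, k3, k4⟩ := hb2 E hE hEn c (sub_JJ (hOU hcU))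
        rcases hNO e (hE he) z hz ha with h | h | rfl | rfl | h
        · exact absurd (hc e he z h ha) (by tauto)
        · exact absurd h k2
        · exact ⟨e, he, Or.inr ha⟩
        · exact ⟨e, he, Or.inl ha⟩
        · exact absurd h k4
    refine b.glue (D1 := D) (D2 := O) (w := w2) (z := y) (b.ih3 hDss hne x w2 w3 hN) hs
      hD hOU hw2 (EP.nil y) (by simpa using y_JJ) (by simpa using hxy) hw2D
      (fun h => ((hOm _).1 h).2.1 rfl) (by simpa using hyw2.symm)
      (fun s hs h => ((hOm _).1 h).2.2.2 hs) ?_ ?_ (by omega)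
    · intro s hs2; simp only [mem_singleton]; rintro rfl; exact b.hy (hD hs2)
    · intro s hs2; simp only [mem_singleton]; rintro rfl; exact b.hy (hOU hs2)

end
end CL

namespace CL
open scoped Classical
open Finset
variable {V : Type*} {H : SimpleGraph V}
section
variable {x y : V} {U : Finset V} {d : ℕ}

theorem JJ_comm : JJ x y U = JJ y x U := by
  ext s; simp only [mem_JJ]; tauto

theorem Bad.symm (b : Bad H x y U d) : Bad H y x U d where
  hxy := b.hxy.symm
  hx := b.hy
  hy := b.hx
  ne := b.ne
  conn2 := by rw [JJ_comm]; exact b.conn2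
  deg := by rw [JJ_comm]; exact b.deg
  k4 := b.k4
  ih := b.ih
  no := fun h => b.no (h.shift (c := 0) (by
    rintro m ⟨S, hS, hp⟩
    exact ⟨S, by rw [JJ_comm]; exact hS, hp.rev⟩))

theorem St.deg5 (st : St H x y U d) {v : V} (hv : v ∈ U) (U' : Finset V) (p q r s t : V)
    (h : ∀ w ∈ JJ x y U, H.Adj v w → w ∈ U' ∨ w = p ∨ w = q ∨ w = r ∨ w = s ∨ w = t) :
    d ≤ #(U'.filter (H.Adj v)) + (if H.Adj v p then 1 else 0) + (if H.Adj v q then 1 else 0) +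
      (if H.Adj v r then 1 else 0) + (if H.Adj v s then 1 else 0) +
      (if H.Adj v t then 1 else 0) := by
  have := st.degR hv U' (insert p (insert q (insert r (insert s (insert t ∅))))) (by simpa using h)
  have h1 := card_fi (a := p) (s := insert q (insert r (insert s (insert t ∅)))) (P := H.Adj v)
  have h2 := card_fi (a := q) (s := insert r (insert s (insert t ∅))) (P := H.Adj v)
  have h3 := card_fi (a := r) (s := insert s (insert t ∅)) (P := H.Adj v)
  have h4 := card_fi (a := s) (s := insert t ∅) (P := H.Adj v)
  have h5 := card_fi (a := t) (s := ∅) (P := H.Adj v)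
  simp only [Finset.filter_empty, Finset.card_empty] at h5
  omega

theorem Bad.small (b : Bad H x y U d) {a c v0 : V} (ha : a ∈ U) (hc : c ∈ U) (hv : v0 ∈ U)
    (hac : a ≠ c) (hxa : H.Adj x a) (hxc : H.Adj x c) (hva : H.Adj v0 a) (hvc : H.Adj v0 c) :
    5 ≤ d := by
  by_contra hd
  have haK : a ∈ U.erase v0 := mem_erase.2 ⟨hva.ne.symm, ha⟩
  have hDU : comp H (U.erase v0) a ⊆ U := comp_sub.trans (erase_subset _ _)
  obtain ⟨f, hf, w, hw, hfw, hn, h1, h2⟩ := b.c3 (E := comp H (U.erase v0) a)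
    ⟨hDU, fun h => (mem_erase.1 (comp_sub (h hv))).1 rfl⟩ ⟨a, comp_self haK⟩ x v0
  have hwy : w = y := by
    rcases mem_JJ.1 hw with h | h | h
    · exact absurd h h1
    · exact h
    · exact absurd (comp_closed hf (mem_erase.2 ⟨h2, h⟩) hfw) hn
  subst hwy
  obtain ⟨S, n, hS, hp⟩ := comp_path hf (comp_self haK)
  have hSU : ∀ s ∈ S, s ∈ U ∧ s ≠ v0 := fun s hs =>
    ⟨mem_of_mem_erase (hS hs), (mem_erase.1 (hS hs)).1⟩
  have hp' := (EP.nil w).app hp hfw.symm (by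
    simp only [mem_singleton]; rintro s rfl h; exact b.hy (hSU _ h).1)
  obtain ⟨t, T, m, ht, q, hT, hTu⟩ := hp'.firstHit (fun z => z = a ∨ z = c) (Or.inl rfl)
  have hT' : ∀ s ∈ T, (s = w ∨ s ∈ U) ∧ s ≠ v0 := by
    intro s hs
    have := hT hs
    simp only [mem_union, mem_singleton] at this
    rcases this with rfl | h
    · exact ⟨Or.inl rfl, fun h => b.hy (h ▸ hv)⟩
    · exact ⟨Or.inr (hSU s h).1, (hSU s h).2⟩
  have hTJ : T ⊆ JJ x w U := by
    intro s hs; rw [mem_JJ]; exact Or.inr (hT' s hs).1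
  have hxT : x ∉ T := by
    intro h
    rcases (hT' x h).1 with h | h
    · exact b.hxy h
    · exact b.hx h
  have key : ∀ t t', t' ∈ U → H.Adj x t → H.Adj x t' → H.Adj v0 t → H.Adj v0 t' → t' ∉ T →
      EP H T w t m → False := by
    intro t t' ht'U h1 h2 h3 h4 h5 q
    refine b.no ((span2 (p := m + 1) ?_ ?_).mono (by omega))
    · have := (EP.nil x).app q.rev h1 (by simpa using hxT)
      refine ⟨_, union_subset (Finset.singleton_subset_iff.2 x_JJ) hTJ, by convert this using 1; omega⟩
    · have := ((ep1 h2).app (EP.nil v0) h4.symm (by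
        simp only [mem_union, mem_singleton]
        rintro s (rfl | rfl) rfl
        · exact b.hx hv
        · exact h4.ne rfl)).app q.rev h3 (by
        simp only [mem_union, mem_singleton]
        rintro s ((rfl | rfl) | rfl) h
        · exact hxT h
        · exact h5 h
        · exact (hT' _ h).2 rfl)
      refine ⟨_, union_subset ?_ hTJ, by convert this using 1; omega⟩
      intro s
      simp only [mem_union, mem_singleton, mem_JJ]
      rintro ((rfl | rfl) | rfl) <;> tauto
  rcases ht with rfl | rfl
  · exact key t c hc hxa hxc hva hvc (fun h => hac (hTu c h (Or.inr rfl)).symm) q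
  · exact key t a ha hxc hxa hvc hva (fun h => hac (hTu a h (Or.inl rfl))) q

set_option maxHeartbeats 2000000 in
theorem Bad.P2 (b : Bad H x y U d) (hd : 5 ≤ d) {a c v0 u : V} (ha : a ∈ U) (hc : c ∈ U)
    (hv : v0 ∈ U)
    (hac : a ≠ c) (hxa : H.Adj x a) (hxc : H.Adj x c) (hva : H.Adj v0 a) (hvc : H.Adj v0 c)
    (hu : u ∈ U) (hua : u ≠ a) (huc : u ≠ c) (huv : u ≠ v0) (huy : H.Adj u y) : False := by
  set U0 := ((U.erase a).erase c).erase v0 with hU0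
  have hm : ∀ s, s ∈ U0 ↔ s ≠ v0 ∧ s ≠ c ∧ s ≠ a ∧ s ∈ U := by intro s; simp [hU0]
  have huK : u ∈ U0 := (hm u).2 ⟨huv, huc, hua, hu⟩
  set D := comp H U0 u with hD
  have hDU0 : D ⊆ U0 := comp_sub
  have hDU : D ⊆ U := fun s hs => ((hm s).1 (hDU0 hs)).2.2.2
  have haD : a ∉ D := fun h => ((hm _).1 (hDU0 h)).2.2.1 rfl
  have hcD : c ∉ D := fun h => ((hm _).1 (hDU0 h)).2.1 rfl
  have hvD : v0 ∉ D := fun h => ((hm _).1 (hDU0 h)).1 rfl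
  have hDss : D ⊂ U := ⟨hDU, fun h => haD (h ha)⟩
  have huD : u ∈ D := comp_self huK
  have hN : ∀ e ∈ D, ∀ w ∈ JJ x y U, H.Adj e w →
      w ∈ D ∨ w = x ∨ w = y ∨ w = a ∨ w = c ∨ w = v0 := by
    intro e he w hw hew
    by_cases hwK : w ∈ U0
    · exact Or.inl (comp_closed he hwK hew)
    · rw [hm] at hwK
      rw [mem_JJ] at hw
      grind
  by_cases hT : ∃ e ∈ D, H.Adj e a ∨ H.Adj e c
  swap
  · push Not at hT
    refine b.F2a (by omega) hDU ⟨u, huD⟩ hv hvD ha haD hva.ne.symm ?_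
    intro e he z hz hez
    rcases hN e he z hz hez with h | h | h | h | h | h
    · grind
    · grind
    · grind
    · exact absurd (h ▸ hez) (hT e he).1
    · exact absurd (h ▸ hez) (hT e he).2
    · grind
  refine b.no ((b.ih.comp huK (fun u => H.Adj u a ∨ H.Adj u c) (fun u => H.Adj u y) (d - 2)
    hDss ?_ hT ⟨u, huD, huy⟩ ?_).add (L2 := fun n => n = 0 ∨ n = 2) (r2 := 2) (c := 3)
      (span2 (p := 0) (Or.inl rfl) (Or.inr rfl)) ?_ (by omega))
  · intro v hvD
    have h5 := b.deg5 (hDU hvD) D x y a c v0 (hN v hvD)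
    have hk : ¬ (H.Adj v v0 ∧ H.Adj v a ∧ H.Adj v c) := fun ⟨k1, k2, k3⟩ =>
      b.k4 v (hDU hvD) v0 hv a ha c hc hac k1 k2 k3 hva hvc
    rw [← hD]
    by_cases k1 : H.Adj v a <;> by_cases k2 : H.Adj v c <;> by_cases k3 : H.Adj v v0 <;>
      by_cases k4 : H.Adj v x <;>
      simp only [k1, k2, k3, k4, if_true, if_false, or_true, true_or, or_false, and_self,
        not_true, and_true, true_and] at h5 hk ⊢ <;> omega
  · intro E hE hEn c' hcD' hcE hEc
    by_contra hcon
    push Not at hcon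
    have hc' := (hm _).1 (hDU0 hcD')
    refine b.F2b hd (hE.trans hDU) hEn (w2 := c') (w3 := v0) (o := a) hc'.2.2.2 hcE hv
      (fun h => hvD (hE h)) hc'.1 ha (fun h => haD (hE h)) hc'.2.2.1.symm hva.ne.symm ?_
    intro e he z hz hez
    rcases hN e (hE he) z hz hez with h | h | h | h | h | h
    · have := hEc e he z h hez; grind
    · grind
    · exact absurd (h ▸ hez) (hcon e he).2
    · exact absurd (h ▸ hez) (hcon e he).1.1
    · exact absurd (h ▸ hez) (hcon e he).1.2
    · grind
  · rintro m n ⟨S, u1, u2, hS, hu1, hu2, hp⟩ hn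
    have hpy := hp.app (EP.nil y) hu2 (by
      intro s hs; simp only [mem_singleton]; rintro rfl; exact b.hy (hDU (hS hs)))
    have hSU : ∀ s ∈ S, s ∈ U := fun s hs => hDU (hS hs)
    have key : ∀ t t', t ∈ U → t' ∈ U → t ≠ t' → H.Adj x t → H.Adj x t' → H.Adj v0 t →
        H.Adj v0 t' → t ∉ S → t' ∉ S → H.Adj u1 t → LL H (JJ x y U) x y (m + n + 3) := by
      intro t t' htU htU' htt h1 h2 h3 h4 h5 h6 h7
      have hpt := (EP.nil t).app hpy h7.symm (by
        simp only [mem_union, mem_singleton]; rintro s rfl (h | rfl)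
        · exact h5 h
        · exact b.hy htU)
      have hxy := b.hxy
      have hxU := b.hx
      have hyU := b.hy
      have hv0S : v0 ∉ S := fun h => hvD (hS h)
      rcases hn with rfl | rfl
      · have := (EP.nil x).app hpt h1 (by
          simp only [mem_union, mem_singleton]; rintro s rfl (rfl | h | rfl)
          · exact hxU htU
          · exact hxU (hSU _ h)
          · exact hxy rfl)
        refine ⟨_, ?_, by convert this using 1; omega⟩
        intro s
        simp only [mem_union, mem_singleton, mem_JJ]
        rintro (rfl | rfl | h | rfl)
        · grind
        · grind
        · have := hSU s h; grind
        · grind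
      · have := ((ep1 h2).app (EP.nil v0) h4.symm (by
          simp only [mem_union, mem_singleton]
          rintro s (rfl | rfl) rfl
          · exact b.hx hv
          · exact h4.ne rfl)).app hpt h3 (by
          simp only [mem_union, mem_singleton]
          rintro s ((rfl | rfl) | rfl) (rfl | h | rfl)
          · exact hxU htU
          · exact hxU (hSU _ h)
          · exact hxy rfl
          · exact htt rfl
          · exact h6 h
          · exact hyU htU'
          · exact h3.ne rfl
          · exact hv0S h
          · exact hyU hv)
        refine ⟨_, ?_, by convert this using 1; omega⟩
        intro s
        simp only [mem_union, mem_singleton, mem_JJ]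
        rintro (((rfl | rfl) | rfl) | rfl | h | rfl)
        · grind
        · grind
        · grind
        · grind
        · have := hSU s h; grind
        · grind
    have haS : a ∉ S := fun h => haD (hS h)
    have hcS : c ∉ S := fun h => hcD (hS h)
    rcases hu1 with h | h
    · exact key a c ha hc hac hxa hxc hva hvc haS hcS h
    · exact key c a hc ha hac.symm hxc hxa hvc hva hcS haS h

set_option maxHeartbeats 2000000 in
theorem Bad.P3b (b : Bad H x y U d) {a c v0 u : V} (ha : a ∈ U) (hc : c ∈ U)
    (hv : v0 ∈ U) (hac : a ≠ c) (hva : H.Adj v0 a) (hvc : H.Adj v0 c)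
    (hya : H.Adj a y) (hyv : H.Adj v0 y)
    (hny : ∀ u ∈ U, u ≠ a → u ≠ c → u ≠ v0 → ¬ H.Adj u y)
    (hu : u ∈ U) (hua : u ≠ a) (huc : u ≠ c) (huv : u ≠ v0) (hux : H.Adj u x) : False := by
  have hd3 := b.d3
  set U0 := ((U.erase a).erase c).erase v0 with hU0
  have hm : ∀ s, s ∈ U0 ↔ s ≠ v0 ∧ s ≠ c ∧ s ≠ a ∧ s ∈ U := by intro s; simp [hU0]
  have huK : u ∈ U0 := (hm u).2 ⟨huv, huc, hua, hu⟩
  set D := comp H U0 u with hD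
  have hDU0 : D ⊆ U0 := comp_sub
  have hDU : D ⊆ U := fun s hs => ((hm s).1 (hDU0 hs)).2.2.2
  have haD : a ∉ D := fun h => ((hm _).1 (hDU0 h)).2.2.1 rfl
  have hvD : v0 ∉ D := fun h => ((hm _).1 (hDU0 h)).1 rfl
  have hDss : D ⊂ U := ⟨hDU, fun h => haD (h ha)⟩
  have huD : u ∈ D := comp_self huK
  have hN : ∀ e ∈ D, ∀ w ∈ JJ x y U, H.Adj e w →
      w ∈ D ∨ w = x ∨ w = a ∨ w = c ∨ w = v0 := by
    intro e he w hw hew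
    by_cases hwK : w ∈ U0
    · exact Or.inl (comp_closed he hwK hew)
    · obtain ⟨k1, k2, k3, k4⟩ := (hm e).1 (hDU0 he)
      have := hny e k4 k3 k2 k1
      rw [hm] at hwK
      rw [mem_JJ] at hw
      grind
  refine b.no ((b.ih.comp huK (fun u => H.Adj u x) (fun u => H.Adj u a ∨ H.Adj u v0) (d - 1)
    hDss ?_ ⟨u, huD, hux⟩ ?_ ?_).add (L2 := fun n => n = 0 ∨ n = 1) (r2 := 1) (c := 3)
      (span1 (p := 0) (Or.inl rfl) (Or.inr rfl)) ?_ (by omega))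
  · intro v hvD
    have h5 := b.deg4 (hDU hvD) D x a c v0 (hN v hvD)
    have hk : ¬ (H.Adj v v0 ∧ H.Adj v a ∧ H.Adj v c) := fun ⟨k1, k2, k3⟩ =>
      b.k4 v (hDU hvD) v0 hv a ha c hc hac k1 k2 k3 hva hvc
    rw [← hD]
    by_cases k1 : H.Adj v a <;> by_cases k2 : H.Adj v c <;> by_cases k3 : H.Adj v v0 <;>
      by_cases k4 : H.Adj v x <;>
      simp only [k1, k2, k3, k4, if_true, if_false, or_true, true_or, or_false, and_self,
        not_true, and_true, true_and] at h5 hk ⊢ <;> omega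
  · obtain ⟨e, he, w, hw, hew, hn, h1, h2⟩ := b.c3 hDss ⟨u, huD⟩ x c
    rcases hN e he w hw hew with h | h | h | h | h
    · exact absurd h hn
    · exact absurd h h1
    · exact ⟨e, he, Or.inl (h ▸ hew)⟩
    · exact absurd h h2
    · exact ⟨e, he, Or.inr (h ▸ hew)⟩
  · intro E hE hEn c' hcD' hcE hEc
    obtain ⟨e, he, w, hw, hew, hn, h1, h2⟩ := b.c3 (lt_of_le_of_lt hE hDss) hEn c' c
    rcases hN e (hE he) w hw hew with h | h | h | h | h
    · exact absurd (hEc e he w h hew) (by tauto)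
    · exact ⟨e, he, Or.inl (h ▸ hew)⟩
    · exact ⟨e, he, Or.inr (Or.inl (h ▸ hew))⟩
    · exact absurd h h2
    · exact ⟨e, he, Or.inr (Or.inr (h ▸ hew))⟩
  · rintro m n ⟨S, u1, u2, hS, hu1, hu2, hp⟩ hn
    have hSU : ∀ s ∈ S, s ∈ U := fun s hs => hDU (hS hs)
    have hpx := (EP.nil x).app hp hu1.symm (by
      simp only [mem_singleton]; rintro s rfl hs; exact b.hx (hSU _ hs))
    have hxy := b.hxy
    have hxU := b.hx
    have hyU := b.hy
    have key : ∀ t t', t ∈ U → t' ∈ U → H.Adj t t' → H.Adj t y → H.Adj t' y →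
        t ∉ S → t' ∉ S → H.Adj u2 t → LL H (JJ x y U) x y (m + n + 3) := by
      intro t t' htU htU' htt h1 h2 h5 h6 h7
      have hpt := hpx.app (EP.nil t) h7 (by
        simp only [mem_union, mem_singleton]; rintro s (rfl | h) rfl
        · exact hxU htU
        · exact h5 h)
      rcases hn with rfl | rfl
      · have := hpt.app (EP.nil y) h1 (by
          simp only [mem_union, mem_singleton]; rintro s ((rfl | h) | rfl) rfl
          · exact hxy rfl
          · exact hyU (hSU _ h)
          · exact hyU htU)
        refine ⟨_, ?_, by convert this using 1; omega⟩
        intro s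
        simp only [mem_union, mem_singleton, mem_JJ]
        rintro (((rfl | h) | rfl) | rfl)
        · grind
        · have := hSU s h; grind
        · grind
        · grind
      · have := hpt.app (ep1 h2) htt (by
          simp only [mem_union, mem_singleton]
          rintro s ((rfl | h) | rfl) (rfl | rfl)
          · exact hxU htU'
          · exact hxy rfl
          · exact h6 h
          · exact hyU (hSU _ h)
          · exact htt.ne rfl
          · exact hyU htU)
        refine ⟨_, ?_, by convert this using 1; omega⟩
        intro s
        simp only [mem_union, mem_singleton, mem_JJ]
        rintro (((rfl | h) | rfl) | rfl | rfl)
        · grind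
        · have := hSU s h; grind
        · grind
        · grind
        · grind
    have haS : a ∉ S := fun h => haD (hS h)
    have hvS : v0 ∉ S := fun h => hvD (hS h)
    rcases hu2 with h | h
    · exact key a v0 ha hv hva.symm hya hyv haS hvS h
    · exact key v0 a hv ha hva hyv hya hvS haS h

set_option maxHeartbeats 2000000 in
theorem Bad.P3c (b : Bad H x y U d) {a c v0 u : V} (ha : a ∈ U) (hc : c ∈ U)
    (hv : v0 ∈ U) (hac : a ≠ c) (hva : H.Adj v0 a) (hvc : H.Adj v0 c)
    (hxa : H.Adj x a) (hyc : H.Adj c y)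
    (hny : ∀ u ∈ U, u ≠ a → u ≠ c → u ≠ v0 → ¬ H.Adj u y)
    (hnx : ∀ u ∈ U, u ≠ a → u ≠ c → u ≠ v0 → ¬ H.Adj u x)
    (hu : u ∈ U) (hua : u ≠ a) (huc : u ≠ c) (huv : u ≠ v0) : False := by
  have hd3 := b.d3
  set U0 := ((U.erase a).erase c).erase v0 with hU0
  have hm : ∀ s, s ∈ U0 ↔ s ≠ v0 ∧ s ≠ c ∧ s ≠ a ∧ s ∈ U := by intro s; simp [hU0]
  have huK : u ∈ U0 := (hm u).2 ⟨huv, huc, hua, hu⟩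
  set D := comp H U0 u with hD
  have hDU0 : D ⊆ U0 := comp_sub
  have hDU : D ⊆ U := fun s hs => ((hm s).1 (hDU0 hs)).2.2.2
  have haD : a ∉ D := fun h => ((hm _).1 (hDU0 h)).2.2.1 rfl
  have hcD : c ∉ D := fun h => ((hm _).1 (hDU0 h)).2.1 rfl
  have hvD : v0 ∉ D := fun h => ((hm _).1 (hDU0 h)).1 rfl
  have hDss : D ⊂ U := ⟨hDU, fun h => haD (h ha)⟩
  have huD : u ∈ D := comp_self huK
  have hN : ∀ e ∈ D, ∀ w ∈ JJ x y U, H.Adj e w → w ∈ D ∨ w = a ∨ w = c ∨ w = v0 := by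
    intro e he w hw hew
    by_cases hwK : w ∈ U0
    · exact Or.inl (comp_closed he hwK hew)
    · obtain ⟨k1, k2, k3, k4⟩ := (hm e).1 (hDU0 he)
      have := hny e k4 k3 k2 k1
      have := hnx e k4 k3 k2 k1
      rw [hm] at hwK
      rw [mem_JJ] at hw
      grind
  have hxy := b.hxy
  have hxU := b.hx
  have hyU := b.hy
  have hvxy : H.Adj x v0 ∨ H.Adj v0 y := by
    by_contra hcon
    push Not at hcon
    have hEm : ∀ s, s ∈ (U.erase a).erase c ↔ s ≠ c ∧ s ≠ a ∧ s ∈ U := by intro s; simp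
    obtain ⟨e, he, w, hw, hew, hn, h1, h2⟩ := b.c3 (E := (U.erase a).erase c)
      ⟨fun s hs => ((hEm s).1 hs).2.2, fun h => ((hEm a).1 (h ha)).2.1 rfl⟩
      ⟨u, (hEm u).2 ⟨huc, hua, hu⟩⟩ a c
    rw [hEm] at he hn
    have h3 := hny e he.2.2 he.2.1 he.1
    have h4 := hnx e he.2.2 he.2.1 he.1
    rcases mem_JJ.1 hw with rfl | rfl | h
    · by_cases hev : e = v0
      · subst hev; exact hcon.1 hew.symm
      · exact h4 hev hew
    · by_cases hev : e = v0
      · subst hev; exact hcon.2 hew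
      · exact h3 hev hew
    · tauto
  refine b.no ((b.ih3 hDss ⟨u, huD⟩ a c v0 hN).add (L2 := fun n => n = 0 ∨ n = 1) (r2 := 1) (c := 4)
      (span1 (p := 0) (Or.inl rfl) (Or.inr rfl)) ?_ (by omega))
  rintro m n ⟨S, u1, u2, hS, hu1, hu2, hp⟩ hn
  have hSU : ∀ s ∈ S, s ∈ U := fun s hs => hDU (hS hs)
  have haS : a ∉ S := fun h => haD (hS h)
  have hcS : c ∉ S := fun h => hcD (hS h)
  have hvS : v0 ∉ S := fun h => hvD (hS h)
  have hva' := hva.ne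
  have hvc' := hvc.ne
  have hmid := ((EP.nil a).app hp hu1.symm (by simpa using haS)).app (EP.nil c) hu2 (by
    simp only [mem_union, mem_singleton]; rintro s (rfl | h) rfl
    · exact hac rfl
    · exact hcS h)
  have hxS : x ∉ S := fun h => hxU (hSU _ h)
  have hyS : y ∉ S := fun h => hyU (hSU _ h)
  have hxa' := hxa.ne
  have hyc' := hyc.ne
  have hxc' : x ≠ c := fun h => hxU (h ▸ hc)
  have hya' : y ≠ a := fun h => hyU (h ▸ ha)
  have hxv' : x ≠ v0 := fun h => hxU (h ▸ hv)
  have hyv' : y ≠ v0 := fun h => hyU (h ▸ hv)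
  rcases hn with rfl | rfl
  · have := ((EP.nil x).app hmid hxa (by
      simp only [mem_union, mem_singleton]; grind)).app (EP.nil y) hyc (by
      simp only [mem_union, mem_singleton]; grind)
    refine ⟨_, ?_, by convert this using 1; omega⟩
    intro s
    simp only [mem_union, mem_singleton, mem_JJ]
    grind
  · rcases hvxy with h | h
    · have := ((ep1 h).app hmid hva (by
        simp only [mem_union, mem_singleton]; grind)).app (EP.nil y) hyc (by
        simp only [mem_union, mem_singleton]; grind)
      refine ⟨_, ?_, by convert this using 1; omega⟩
      intro s
      simp only [mem_union, mem_singleton, mem_JJ]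
      grind
    · have := ((EP.nil x).app hmid hxa (by
        simp only [mem_union, mem_singleton]; grind)).app (ep1 h) hvc.symm (by
        simp only [mem_union, mem_singleton]; grind)
      refine ⟨_, ?_, by convert this using 1; omega⟩
      intro s
      simp only [mem_union, mem_singleton, mem_JJ]
      grind

theorem Bad.ytwo (b : Bad H x y U d) {w z : V} (hw : w ∈ U) (hz : z ∈ U) (hzw : z ≠ w) :
    ∃ f ∈ U, f ≠ w ∧ H.Adj f y := by
  obtain ⟨e, he, t, ht, het, hn, h1, h2⟩ := b.c3 (E := U.erase w)
    ⟨erase_subset _ _, fun h => (mem_erase.1 (h hw)).1 rfl⟩ ⟨z, mem_erase.2 ⟨hzw, hz⟩⟩ x w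
  rw [mem_erase] at he hn
  rcases mem_JJ.1 ht with h | rfl | h
  · exact absurd h h1
  · exact ⟨e, he.2, he.1, het⟩
  · exact absurd ⟨h2, h⟩ hn

theorem Bad.case2 (b : Bad H x y U d) {a c v0 : V} (ha : a ∈ U) (hc : c ∈ U) (hv : v0 ∈ U)
    (hac : a ≠ c) (hxa : H.Adj x a) (hxc : H.Adj x c) (hva : H.Adj v0 a) (hvc : H.Adj v0 c) :
    False := by
  have hd := b.small ha hc hv hac hxa hxc hva hvc
  have hny : ∀ u ∈ U, u ≠ a → u ≠ c → u ≠ v0 → ¬ H.Adj u y := fun u hu h1 h2 h3 h =>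
    b.P2 hd ha hc hv hac hxa hxc hva hvc hu h1 h2 h3 h
  by_cases hx : ∃ u ∈ U, u ≠ a ∧ u ≠ c ∧ u ≠ v0 ∧ H.Adj u x
  · obtain ⟨u, hu, h1, h2, h3, h4⟩ := hx
    by_cases hya : H.Adj a y
    · by_cases hyc : H.Adj c y
      · exact b.symm.P2 hd ha hc hv hac hya.symm hyc.symm hva hvc hu h1 h2 h3 h4
      · obtain ⟨f, hf, hfa, hfy⟩ := b.ytwo ha hc hac.symm
        have hfv : f = v0 := by
          by_contra hfv
          by_cases hfc : f = c
          · subst hfc; exact hyc hfy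
          · exact hny f hf hfa hfc hfv hfy
        subst hfv
        exact b.P3b ha hc hv hac hva hvc hya hfy hny hu h1 h2 h3 h4
    · obtain ⟨f, hf, hfa, hfy⟩ := b.ytwo hc ha hac
      have hfv : f = v0 := by
        by_contra hfv
        by_cases hfc : f = a
        · subst hfc; exact hya hfy
        · exact hny f hf hfc hfa hfv hfy
      subst hfv
      obtain ⟨g, hg, hga, hgy⟩ := b.ytwo hf ha hva.ne.symm
      have hgc : g = c := by
        by_contra hgc
        by_cases hgc' : g = a
        · subst hgc'; exact hya hgy
        · exact hny g hg hgc' hgc hga hgy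
      subst hgc
      exact b.P3b hc ha hv hac.symm hvc hva hgy hfy (fun u hu k1 k2 => hny u hu k2 k1) hu h2 h1 h3 h4
  · have hnx : ∀ u ∈ U, u ≠ a → u ≠ c → u ≠ v0 → ¬ H.Adj u x := fun u hu h1 h2 h3 h =>
      hx ⟨u, hu, h1, h2, h3, h⟩
    have hu : ∃ u ∈ U, u ≠ a ∧ u ≠ c ∧ u ≠ v0 := by
      by_contra hcon
      have h4 := b.deg4 ha ∅ x y c v0 (by
        intro w hw haw
        have := haw.ne
        rcases mem_JJ.1 hw with h | h | h
        · tauto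
        · tauto
        · by_contra h'
          push Not at h'
          exact hcon ⟨w, h, this.symm, h'.2.2.2⟩)
      simp only [Finset.filter_empty, Finset.card_empty] at h4
      split_ifs at h4 <;> omega
    obtain ⟨u, hu, h1, h2, h3⟩ := hu
    obtain ⟨f, hf, hfa, hfy⟩ := b.ytwo hv ha hva.ne.symm
    by_cases hfc : f = c
    · subst hfc
      exact b.P3c ha hc hv hac hva hvc hxa hfy hny hnx hu h1 h2 h3
    · have hfa' : f = a := by
        by_contra h
        exact hny f hf h hfc hfa hfy
      subst hfa'
      exact b.P3c hc ha hv hac.symm hvc hva hxc hfy (fun u hu k1 k2 => hny u hu k2 k1)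
        (fun u hu k1 k2 => hnx u hu k2 k1) hu h2 h1 h3

theorem Bad.false (b : Bad H x y U d) : False := by
  refine b.case1 ?_
  intro v hv a ha a' ha' hxa hxa' hva hva'
  by_contra hne
  exact b.case2 ha ha' hv hne hxa hxa' hva hva'

end
end CL

namespace CL
open scoped Classical
open Finset
variable {V : Type*} {H : SimpleGraph V}

def HH (H : SimpleGraph V) (x y : V) (U : Finset V) (A B : V → Prop) : SimpleGraph V where
  Adj u v := u ≠ v ∧ ((u ∈ U ∧ v ∈ U ∧ H.Adj u v) ∨ (u = x ∧ v ∈ U ∧ A v) ∨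
    (v = x ∧ u ∈ U ∧ A u) ∨ (u = y ∧ v ∈ U ∧ B v) ∨ (v = y ∧ u ∈ U ∧ B u))
  symm := ⟨by
    rintro u v ⟨h, h'⟩
    refine ⟨h.symm, ?_⟩
    rcases h' with ⟨h1, h2, h3⟩ | h' | h' | h' | h'
    · exact Or.inl ⟨h2, h1, h3.symm⟩
    · tauto
    · tauto
    · tauto
    · tauto⟩
  loopless := ⟨fun u h => h.1 rfl⟩

section
variable {x y : V} {U : Finset V} {d : ℕ} {A B : V → Prop}

theorem HH_U (hx : x ∉ U) (hy : y ∉ U) {u v : V} (hu : u ∈ U) (hv : v ∈ U) :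
    (HH H x y U A B).Adj u v ↔ H.Adj u v := by
  have h1 : u ≠ x := fun h => hx (h ▸ hu)
  have h2 : v ≠ x := fun h => hx (h ▸ hv)
  have h3 : u ≠ y := fun h => hy (h ▸ hu)
  have h4 : v ≠ y := fun h => hy (h ▸ hv)
  have h5 : H.Adj u v → u ≠ v := fun h => h.ne
  simp only [HH]
  tauto

theorem HH_x (hxy : x ≠ y) (hx : x ∉ U) {u : V} (hu : u ∈ U) :
    (HH H x y U A B).Adj u x ↔ A u := by
  have h1 : u ≠ x := fun h => hx (h ▸ hu)
  simp only [HH]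
  tauto

theorem HH_y (hxy : x ≠ y) (hy : y ∉ U) {u : V} (hu : u ∈ U) :
    (HH H x y U A B).Adj u y ↔ B u := by
  have h1 : u ≠ y := fun h => hy (h ▸ hu)
  have := hxy.symm
  simp only [HH]
  tauto

theorem HH_x' (hxy : x ≠ y) (hx : x ∉ U) {u : V} (h : (HH H x y U A B).Adj x u) :
    u ∈ U ∧ A u := by
  simp only [HH] at h
  tauto

theorem HH_y' (hxy : x ≠ y) (hy : y ∉ U) {u : V} (h : (HH H x y U A B).Adj y u) :
    u ∈ U ∧ B u := by
  have := hxy.symm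
  simp only [HH] at h
  tauto

theorem HH_path (hxy : x ≠ y) (hx : x ∉ U) (hy : y ∉ U) {n : ℕ}
    (h : LL (HH H x y U A B) (JJ x y U) x y n) : ∃ m, n = m + 2 ∧ LAB H U A B m := by
  obtain ⟨S, hS, hp⟩ := h
  cases hp with
  | nil => exact absurd rfl hxy
  | @cons S _ w _ n hxS h hp =>
    obtain ⟨hwU, hAw⟩ := HH_x' hxy hx h
    have hr := hp.rev
    cases hr with
    | nil => exact absurd hwU hy
    | @cons S _ z _ n hyS h' hp' =>
      obtain ⟨hzU, hBz⟩ := HH_y' hxy hy h'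
      have hSU : S ⊆ U := by
        intro s hs
        have := hS (mem_insert_of_mem (mem_insert_of_mem hs))
        rcases mem_JJ.1 this with rfl | rfl | h
        · exact absurd (mem_insert_of_mem hs) hxS
        · exact absurd hs hyS
        · exact h
      refine ⟨n, by omega, S, w, z, hSU, hAw, hBz, hp'.rev.mono ?_⟩
      intro a ha b hb hab
      exact (HH_U hx hy (hSU ha) (hSU hb)).1 hab

theorem HH_st (hxy : x ≠ y) (hx : x ∉ U) (hy : y ∉ U) (hne : U.Nonempty)
    (hdeg : ∀ v ∈ U, d ≤ #(U.filter (H.Adj v)) + (if A v then 1 else 0) + (if B v then 1 else 0))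
    (h0 : ∀ E ⊆ U, E.Nonempty → (∀ e ∈ E, ∀ w ∈ U, H.Adj e w → w ∈ E) →
      (∃ e ∈ E, A e) ∧ (∃ e ∈ E, B e))
    (h1 : ∀ E ⊆ U, E.Nonempty → ∀ c ∈ U, c ∉ E →
      (∀ e ∈ E, ∀ w ∈ U, H.Adj e w → w ∈ E ∨ w = c) → ∃ e ∈ E, A e ∨ B e)
    (k4 : ∀ p ∈ U, ∀ q ∈ U, ∀ r ∈ U, ∀ s ∈ U, r ≠ s → H.Adj p q → H.Adj p r → H.Adj p s →
      H.Adj q r → H.Adj q s → False) : St (HH H x y U A B) x y U d where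
  hxy := hxy
  hx := hx
  hy := hy
  ne := hne
  conn2 := by
    intro E hE hEn p
    by_cases hcl : ∀ e ∈ E, ∀ w ∈ U, H.Adj e w → w ∈ E
    · obtain ⟨⟨e, he, hA⟩, ⟨e', he', hB⟩⟩ := h0 E hE hEn hcl
      by_cases hp : p = x
      · subst hp
        exact ⟨e', he', y, y_JJ, (HH_y hxy hy (hE he')).2 hB, fun h => hy (hE h), hxy.symm⟩
      · exact ⟨e, he, x, x_JJ, (HH_x hxy hx (hE he)).2 hA, fun h => hx (hE h), fun h => hp h.symm⟩
    · push Not at hcl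
      obtain ⟨e, he, w, hw, ha, hn⟩ := hcl
      by_cases hwp : w = p
      · subst hwp
        by_cases hcl' : ∀ e ∈ E, ∀ z ∈ U, H.Adj e z → z ∈ E ∨ z = w
        · obtain ⟨f, hf, hAB⟩ := h1 E hE hEn w hw hn hcl'
          rcases hAB with h | h
          · exact ⟨f, hf, x, x_JJ, (HH_x hxy hx (hE hf)).2 h, fun h => hx (hE h),
              fun h => hx (h ▸ hw)⟩
          · exact ⟨f, hf, y, y_JJ, (HH_y hxy hy (hE hf)).2 h, fun h => hy (hE h),
              fun h => hy (h ▸ hw)⟩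
        · push Not at hcl'
          obtain ⟨e, he, z, hz, ha, hn, hne⟩ := hcl'
          exact ⟨e, he, z, sub_JJ hz, (HH_U hx hy (hE he) hz).2 ha, hn, hne⟩
      · exact ⟨e, he, w, sub_JJ hw, (HH_U hx hy (hE he) hw).2 ha, hn, hwp⟩
  deg := by
    intro v hv
    refine (hdeg v hv).trans ?_
    have hU : U.filter ((HH H x y U A B).Adj v) = U.filter (H.Adj v) :=
      Finset.filter_congr (fun w hw => HH_U hx hy hv hw)
    have hx' : ∀ P : V → Prop, x ∉ U.filter P := fun P h => hx (mem_filter.1 h).1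
    have hy' : ∀ P : V → Prop, y ∉ U.filter P := fun P h => hy (mem_filter.1 h).1
    rw [JJ, Finset.filter_insert, Finset.filter_insert, hU]
    simp only [HH_x hxy hx hv, HH_y hxy hy hv]
    have hxy' : x ∉ insert y (U.filter (H.Adj v)) := by
      rw [mem_insert]; rintro (h | h)
      · exact hxy h
      · exact hx' _ h
    by_cases hA : A v <;> by_cases hB : B v <;>
      simp only [hA, hB, if_true, if_false, card_insert_of_notMem hxy',
        card_insert_of_notMem (hx' (H.Adj v)), card_insert_of_notMem (hy' (H.Adj v))] <;> omega
  k4 := by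
    intro p hp q hq r hr s hs hrs
    rw [HH_U hx hy hp hq, HH_U hx hy hp hr, HH_U hx hy hp hs, HH_U hx hy hq hr, HH_U hx hy hq hs]
    exact k4 p hp q hq r hr s hs hrs

theorem Span.down {L1 L : ℕ → Prop} {r : ℕ} (h : Span L1 r)
    (hd : ∀ n, L1 n → ∃ m, n = m + 2 ∧ L m) : Span L r := by
  obtain ⟨p, q, h1, h2, h3, h4⟩ := h
  obtain ⟨p', rfl, hp'⟩ := hd p h2
  obtain ⟨q', rfl, hq'⟩ := hd q h3
  refine ⟨p', q', by omega, hp', hq', fun n k1 k2 => ?_⟩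
  rcases h4 (n + 2) (by omega) (by omega) with h | h
  · obtain ⟨m, hm, hL⟩ := hd _ h
    left; rwa [show n = m by omega]
  · obtain ⟨m, hm, hL⟩ := hd _ h
    right; rwa [show n + 1 = m by omega]

end

theorem main (N : ℕ) : ∀ (H : SimpleGraph V) (x y : V) (U : Finset V) (d : ℕ), #U = N →
    St H x y U d → Span (LL H (JJ x y U) x y) (d - 2) := by
  induction N using Nat.strong_induction_on with
  | _ N IH =>
    intro H x y U d hN st
    by_contra hno
    refine Bad.false (H := H) (x := x) (y := y) (U := U) (d := d) ⟨st, ?_, hno⟩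
    intro U' A B d' hU' hne hdeg h0 h1
    have hx : x ∉ U' := fun h => st.hx (hU'.1 h)
    have hy : y ∉ U' := fun h => st.hy (hU'.1 h)
    refine (IH _ (hN ▸ Finset.card_lt_card hU') _ x y U' d' rfl
      (HH_st st.hxy hx hy hne hdeg h0 h1 ?_)).down (fun n => HH_path st.hxy hx hy)
    intro p hp q hq r hr s hs
    exact st.k4 p (hU'.1 hp) q (hU'.1 hq) r (hU'.1 hr) s (hU'.1 hs)

theorem EP.walk {S : Finset V} {u v : V} {n : ℕ} (h : EP H S u v n) :
    ∃ p : H.Walk u v, p.IsPath ∧ p.length = n ∧ ∀ s ∈ p.support, s ∈ S := by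
  induction h with
  | nil u => exact ⟨SimpleGraph.Walk.nil, by simp, rfl, by simp⟩
  | @cons S u w v n hu h hp ih =>
    obtain ⟨p, h1, h2, h3⟩ := ih
    refine ⟨SimpleGraph.Walk.cons h p, ?_, by simp [h2], ?_⟩
    · rw [SimpleGraph.Walk.cons_isPath_iff]
      exact ⟨h1, fun h => hu (h3 _ h)⟩
    · intro s hs
      rw [SimpleGraph.Walk.support_cons, List.mem_cons] at hs
      rcases hs with rfl | hs
      · exact mem_insert_self _ _
      · exact mem_insert_of_mem (h3 s hs)

theorem EP.cycle {S : Finset V} {u v : V} {n : ℕ} (h : EP H S u v n) (hn : 2 ≤ n)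
    (ha : H.Adj v u) : HasCycleLength H (n + 1) := by
  cases h with
  | nil => omega
  | @cons S _ w _ n hu h hp =>
    obtain ⟨p, h1, h2, h3⟩ := hp.walk
    have hup : u ∉ p.support := fun h => hu (h3 _ h)
    refine ⟨v, SimpleGraph.Walk.cons ha (SimpleGraph.Walk.cons h p), ?_, by simp [h2]⟩
    rw [SimpleGraph.Walk.cons_isCycle_iff, SimpleGraph.Walk.cons_isPath_iff]
    refine ⟨⟨h1, hup⟩, ?_⟩
    rw [SimpleGraph.Walk.edges_cons, List.mem_cons]
    rintro (h' | h')
    · have hvw : v = w := by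
        rw [Sym2.eq_iff] at h'
        rcases h' with h' | h'
        · exact absurd h'.1 ha.ne
        · exact h'.1
      subst hvw
      cases hp with
      | nil => omega
      | cons hu2 _ hp2 => exact hu2 hp2.right
    · exact hup (SimpleGraph.Walk.snd_mem_support_of_mem_edges p h')

theorem kc {G : SimpleGraph V} [Fintype V] (h3 : KConnected 3 G) (s : Finset V) (hs : #s < 3)
    (E : Finset V) {e z : V} (he : e ∈ E) (hes : e ∉ s) (hz : z ∉ s)
    (hc : ∀ e ∈ E, ∀ w, w ∉ s → G.Adj e w → w ∈ E) : z ∈ E := by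
  have hcon := (h3.2 s hs).preconnected ⟨e, by simpa using hes⟩ ⟨z, by simpa using hz⟩
  obtain ⟨p⟩ := hcon
  have : ∀ (a b : ((↑s : Set V)ᶜ : Set V)) (_ : (G.induce ((↑s : Set V)ᶜ)).Walk a b),
      (a : V) ∈ E → (b : V) ∈ E := by
    intro a b p
    induction p with
    | nil => exact id
    | @cons u v w h p ih =>
      intro hu
      exact ih (hc _ hu _ (fun h => v.2 (Finset.mem_coe.2 h)) (by simpa using h))
  exact this _ _ p he

theorem final [Fintype V] (k : ℕ) (G : SimpleGraph V)
    (h3 : KConnected 3 G) (hdeg : ∀ v : V, k ≤ #((Finset.univ : Finset V).filter (G.Adj v)))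
    (htriangle : ¬ G.CliqueFree 3) (hK4 : ¬ ContainsK4Minus G) :
    ∃ ℓ : ℕ, ∀ i < k, HasCycleLength G (ℓ + i) := by
  rw [SimpleGraph.CliqueFree] at htriangle
  push Not at htriangle
  obtain ⟨t, ht⟩ := htriangle
  rw [SimpleGraph.is3Clique_iff] at ht
  obtain ⟨x1, x2, x3, h12, h13, h23, rfl⟩ := ht
  set T : Finset V := {x1, x2, x3} with hT
  set U : Finset V := univ \ T with hU
  have hm : ∀ s, s ∈ U ↔ s ≠ x1 ∧ s ≠ x2 ∧ s ≠ x3 := by intro s; simp [hU, hT]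
  have hne : U.Nonempty := by
    rw [← Finset.card_pos, hU, Finset.card_sdiff_of_subset (subset_univ _)]
    have := h3.1
    have h' : #T ≤ 3 := Finset.card_le_three
    rw [Finset.card_univ]
    omega
  have hx : x1 ∉ U := fun h => ((hm _).1 h).1 rfl
  have hy : x2 ∉ U := fun h => ((hm _).1 h).2.1 rfl
  have hz : x3 ∉ U := fun h => ((hm _).1 h).2.2 rfl
  have hk4 : ∀ p ∈ U, ∀ q ∈ U, ∀ r ∈ U, ∀ s ∈ U, r ≠ s → G.Adj p q → G.Adj p r → G.Adj p s →
      G.Adj q r → G.Adj q s → False := fun p _ q _ r _ s _ h1 h2 h3 h4 h5 h6 =>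
    hK4 ⟨p, q, r, s, h1, h2, h3, h4, h5, h6⟩
  have st := HH_st (H := G) (x := x1) (y := x2) (U := U) (d := k) (A := fun v => G.Adj v x1)
    (B := fun v => G.Adj v x2 ∨ G.Adj v x3) h12.ne hx hy hne
    (by
      intro v hv
      have hno : ¬ (G.Adj v x2 ∧ G.Adj v x3) := fun ⟨k2, k3⟩ =>
        hK4 ⟨x2, x3, x1, v, (((hm v).1 hv).1).symm, h23, h12.symm, k2.symm, h13.symm, k3.symm⟩
      have hle : #((Finset.univ : Finset V).filter (G.Adj v)) ≤ #(U.filter (G.Adj v)) +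
          #((insert x1 (insert x2 (insert x3 ∅)) : Finset V).filter (G.Adj v)) := by
        refine le_trans (Finset.card_le_card ?_) (Finset.card_union_le _ _)
        intro w hw
        replace hw := (mem_filter.1 hw).2
        simp only [mem_union, mem_filter, hm, mem_insert]
        tauto
      have g1 := card_fi (a := x1) (s := insert x2 (insert x3 ∅)) (P := G.Adj v)
      have g2 := card_fi (a := x2) (s := insert x3 ∅) (P := G.Adj v)
      have g3 := card_fi (a := x3) (s := ∅) (P := G.Adj v)
      simp only [Finset.filter_empty, Finset.card_empty] at g3
      have hk := hdeg v
      by_cases k2 : G.Adj v x2 <;> by_cases k3 : G.Adj v x3 <;>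
        simp only [k2, k3, if_true, if_false, or_true, or_false, and_self,
          not_true] at g2 g3 hno ⊢ <;> omega)
    (by
      intro E hE hEn hc
      obtain ⟨e, he⟩ := hEn
      have heU := (hm e).1 (hE he)
      constructor
      · by_contra hcon
        push Not at hcon
        refine hx (hE (kc h3 {x2, x3} (lt_of_le_of_lt Finset.card_le_two (by omega)) E he ?_ ?_ ?_))
        · simp; tauto
        · simp; exact ⟨h12.ne, h13.ne⟩
        · intro f hf w hw hfw
          simp only [mem_insert, mem_singleton] at hw
          refine hc f hf w ((hm w).2 ⟨?_, by tauto, by tauto⟩) hfw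
          rintro rfl; exact hcon f hf hfw
      · by_contra hcon
        push Not at hcon
        refine hy (hE (kc h3 {x1} (by simp) E he ?_ ?_ ?_))
        · simp; tauto
        · simp; exact h12.ne.symm
        · intro f hf w hw hfw
          simp only [mem_singleton] at hw
          refine hc f hf w ((hm w).2 ⟨hw, ?_, ?_⟩) hfw
          · rintro rfl; exact (hcon f hf).1 hfw
          · rintro rfl; exact (hcon f hf).2 hfw)
    (by
      intro E hE hEn c hcU hcE hc
      obtain ⟨e, he⟩ := hEn
      by_contra hcon
      push Not at hcon
      refine hx (hE (kc h3 {c} (by simp) E he ?_ ?_ ?_))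
      · simp only [mem_singleton]; rintro rfl; exact hcE he
      · simp only [mem_singleton]; rintro rfl; exact hx hcU
      · intro f hf w hw hfw
        simp only [mem_singleton] at hw
        refine (hc f hf w ((hm w).2 ⟨?_, ?_, ?_⟩) hfw).resolve_right hw
        · rintro rfl; exact (hcon f hf).1 hfw
        · rintro rfl; exact (hcon f hf).2.1 hfw
        · rintro rfl; exact (hcon f hf).2.2 hfw)
    hk4
  have hspan := (main _ _ _ _ _ _ rfl st).down (fun n => HH_path h12.ne hx hy)
  have hcyc : ∀ m, LAB G U (fun v => G.Adj v x1) (fun v => G.Adj v x2 ∨ G.Adj v x3) m →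
      HasCycleLength G (m + 3) ∧ HasCycleLength G (m + 4) := by
    rintro m ⟨S, u, u', hS, hu, hu', hp⟩
    have h1S : x1 ∉ S := fun h => hx (hS h)
    have hp1 := (EP.nil x1).app hp hu.symm (by simpa using h1S)
    have key : ∀ y z, y ∉ S → z ∉ S → G.Adj x1 y → G.Adj x1 z → G.Adj y z → G.Adj u' y →
        HasCycleLength G (m + 3) ∧ HasCycleLength G (m + 4) := by
      intro y z hyS hzS a1 a2 a3 a4
      have hp2 := hp1.app (EP.nil y) a4 (by
        simp only [mem_union, mem_singleton]
        rintro s (rfl | h) rfl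
        · exact a1.ne rfl
        · exact hyS h)
      have hp3 := hp2.app (EP.nil z) a3 (by
        simp only [mem_union, mem_singleton]
        rintro s ((rfl | h) | rfl) rfl
        · exact a2.ne rfl
        · exact hzS h
        · exact a3.ne rfl)
      constructor
      · have := hp2.cycle (by omega) a1.symm
        convert this using 1; omega
      · have := hp3.cycle (by omega) a2.symm
        convert this using 1; omega
    have h2S : x2 ∉ S := fun h => hy (hS h)
    have h3S : x3 ∉ S := fun h => hz (hS h)
    rcases hu' with h | h
    · exact key x2 x3 h2S h3S h12 h13 h23 h
    · exact key x3 x2 h3S h2S h13 h12 h23.symm h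
  obtain ⟨p, q, hpq, hp, hq, hall⟩ := hspan
  refine ⟨p + 3, fun i hi => ?_⟩
  by_cases h0 : p + i < q
  · by_cases hi0 : i = 0
    · subst hi0; exact (hcyc p hp).1
    · rcases hall (p + i - 1) (by omega) (by omega) with h | h
      · have := (hcyc _ h).2
        convert this using 1; omega
      · have := (hcyc _ h).1
        convert this using 1; omega
  · by_cases h1 : p + i = q
    · have := (hcyc _ hq).1
      convert this using 1; omega
    · have h2 : p + i = q + 1 := by omega
      have := (hcyc _ hq).2
      convert this using 1; omega

end CL

/-- Lemma 5.2 of [GHLM]: for `k ≥ 3`, a 3-connected graph of minimum degree at least `k`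
containing a triangle but no `K₄⁻` contains `k` cycles of consecutive lengths. -/
theorem stmt_6 {V : Type*} [Fintype V] (k : ℕ) (hk : 3 ≤ k)
    (G : SimpleGraph V) [DecidableRel G.Adj]
    (h3 : KConnected 3 G) (hdeg : ∀ v : V, k ≤ G.degree v)
    (htriangle : ¬ G.CliqueFree 3) (hK4 : ¬ ContainsK4Minus G) :
    ∃ ℓ : ℕ, ∀ i < k, HasCycleLength G (ℓ + i) := by
  classical
  refine CL.final k G h3 (fun v => le_trans (hdeg v) ?_) htriangle hK4
  rw [← SimpleGraph.card_neighborFinset_eq_degree]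
  refine Finset.card_le_card fun w hw => ?_
  rw [SimpleGraph.mem_neighborFinset] at hw
  exact (@Finset.mem_filter _ (G.Adj v) (_) _ _).2 ⟨Finset.mem_univ _, hw⟩
end

section
/- Let G be a finite simple graph comprising a cycle with a chord (that is, G consists of a cycle through all its vertices together with exactly one additional edge joining two non-consecutive vertices of that cycle), and let (A, B) be a non-trivial partition of V(G). Then G contains A-B paths of every length ℓ with 1 ≤ ℓ < |V(G)|, unless G is bipartite with bipartition (A, B). -/
theorem core (n r m : ℤ) (χ : ℤ → Prop) (hm : 1 ≤ m) (hmn : m < n) (hr : 2 ≤ r) (hrn : r ≤ n - 2)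
    (hper : ∀ x, χ (x + n) ↔ χ x)
    (hnc : ¬ ∀ x, χ (x + 1) ↔ χ x)
    (H : ∀ h : ℤ → ℤ, (∀ j, 0 ≤ j → j < m → h (j+1) = h j + 1 ∨ h (j+1) = h j - 1 ∨
        (h j = 0 ∧ h (j+1) = r)) →
      (∀ i j, 0 ≤ i → i < j → j ≤ m → h i ≠ h j ∧ h i - h j < n ∧ h j - h i < n) →
      (χ (h 0) ↔ χ (h m))) :
    (∀ x, χ (x + 1) ↔ ¬ χ x) ∧ r % 2 = 1 := by
  have hmper : ∀ x, χ (x + m) ↔ χ x := by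
    intro x
    have := H (fun j => x + j) (fun j _ _ => Or.inl (by ring)) (fun i j _ _ _ => by
      refine ⟨by simp; omega, by simp; omega, by simp; omega⟩)
    simpa using this.symm
  have C : ∀ ε δ a b : ℤ, (ε = 1 ∨ ε = -1) → (δ = 1 ∨ δ = -1) → 0 ≤ a → 0 ≤ b → a + b + 1 = m →
      (∀ i j, 0 ≤ i → i ≤ a → 0 ≤ j → j ≤ b → ε * i ≠ r + δ * j ∧ ε * i - (r + δ * j) < n ∧
        (r + δ * j) - ε * i < n) → (χ (ε * a) ↔ χ (r + δ * b)) := by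
    intro ε δ a b hε hδ ha hb hab hinj
    have := H (fun j => if j ≤ a then ε * (a - j) else r + δ * (j - a - 1)) ?_ ?_
    · simp only [ha, if_true, sub_zero] at this
      rw [if_neg (by omega), show m - a - 1 = b by omega] at this
      exact this
    · intro j hj hjm
      try dsimp only
      rcases hε with rfl | rfl <;> rcases hδ with rfl | rfl <;> split_ifs <;> omega
    · intro i j hi hij hj
      try dsimp only
      split_ifs with h1 h2 h2
      · rcases hε with rfl | rfl <;> omega
      · have := hinj (a - i) (j - a - 1) (by omega) (by omega) (by omega) (by omega)
        exact this
      · omega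
      · rcases hδ with rfl | rfl <;> omega
  let P : AddSubgroup ℤ :=
    { carrier := {p | ∀ x, χ (x + p) ↔ χ x}
      zero_mem' := by intro x; simp
      add_mem' := by
        intro a b ha hb x
        rw [← add_assoc]; exact (hb _).trans (ha _)
      neg_mem' := by
        intro a ha x
        have := ha (x + -a)
        simpa using this.symm }
  obtain ⟨d, hd0, hd⟩ : ∃ d : ℤ, 0 ≤ d ∧ ∀ p, (∀ x, χ (x + p) ↔ χ x) ↔ d ∣ p := by
    obtain ⟨g, hg⟩ := Int.subgroup_cyclic P
    refine ⟨|g|, abs_nonneg _, fun p => ?_⟩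
    rw [abs_dvd, ← Int.mem_zmultiples_iff, ← AddSubgroup.zmultiples_eq_closure] at *
    rw [← hg]; rfl
  have hdn := (hd n).1 hper
  have hdm := (hd m).1 hmper
  have hdnm : d ∣ n - m := dvd_sub hdn hdm
  have h1 : d ≤ m := Int.le_of_dvd (by omega) hdm
  have h2 : d ≤ n - m := Int.le_of_dvd (by omega) hdnm
  have hdpos : 0 < d := by
    rcases hd0.lt_or_eq with h | h
    · exact h
    · subst h; have := zero_dvd_iff.1 hdm; omega
  have hcong : ∀ x y, d ∣ x - y → (χ x ↔ χ y) := by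
    intro x y h
    have := (hd _).2 h y
    simpa using this
  have hd1 : d ≠ 1 := by
    intro h; exact hnc ((hd 1).2 (by rw [h]))
  have hrd : d ≤ r := by
    by_contra hlt
    push Not at hlt
    have : d ∣ r - 1 := by
      rw [← hd]
      intro x
      have h3 := Int.emod_nonneg (-x) hdpos.ne'
      have h4 := Int.emod_lt_of_pos (-x) hdpos
      have h5 : d ∣ (-x) % d + x := by
        have := Int.dvd_self_sub_emod (x := -x) (m := d)
        have := (dvd_neg.2 this); exact this.trans (dvd_of_eq (by ring))
      set a := (-x) % d
      have := C (-1) 1 a (m - 1 - a) (by simp) (by simp) (by omega) (by omega) (by omega)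
        (by intros; omega)
      rw [hcong x (-1 * a) (by exact h5.trans (dvd_of_eq (by ring))), this]
      apply hcong
      have := dvd_sub h5 hdm
      exact this.trans (dvd_of_eq (by ring))
    have := Int.le_of_dvd (by omega) this
    omega
  have hnrd : d ≤ n - r := by
    by_contra hlt
    push Not at hlt
    have : d ∣ r + 1 := by
      rw [← hd]
      intro x
      have h3 := Int.emod_nonneg (x) hdpos.ne'
      have h4 := Int.emod_lt_of_pos (x) hdpos
      have h5 : d ∣ x - x % d := Int.dvd_self_sub_emod (x := x) (m := d)
      set a := x % d
      have := C 1 (-1) a (m - 1 - a) (by simp) (by simp) (by omega) (by omega) (by omega)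
        (by intros; omega)
      rw [hcong x (1 * a) (by exact h5.trans (dvd_of_eq (by ring))), this]
      apply hcong
      have := dvd_add h5 hdm
      exact this.trans (dvd_of_eq (by ring))
    have := dvd_sub hdn this
    have := Int.le_of_dvd (by omega) this
    omega
  have R : ∀ L x : ℤ, ∃ a, L ≤ a ∧ a < L + d ∧ d ∣ x - a := by
    intro L x
    have h3 := Int.emod_nonneg (x - L) hdpos.ne'
    have h4 := Int.emod_lt_of_pos (x - L) hdpos
    have h5 : d ∣ (x - L) - (x - L) % d := Int.dvd_self_sub_emod
    refine ⟨L + (x - L) % d, by omega, by omega, ?_⟩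
    exact h5.trans (dvd_of_eq (by ring))
  have E1 : ∀ x, χ x ↔ χ (r - 1 - x) := by
    intro x
    obtain ⟨a, ha1, ha2, ha⟩ := R (max 0 (m - n + r)) x
    have := C 1 1 a (m - 1 - a) (by simp) (by simp) (by omega) (by omega) (by omega)
        (by intros; omega)
    rw [hcong x (1 * a) (by exact ha.trans (dvd_of_eq (by ring))), this]
    apply hcong
    have := dvd_add ha hdm
    exact this.trans (dvd_of_eq (by ring))
  have E2 : ∀ x, χ x ↔ χ (r + 1 - x) := by
    intro x
    obtain ⟨a, ha1, ha2, ha⟩ := R (max 0 (m - r)) (-x)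
    have := C (-1) (-1) a (m - 1 - a) (by simp) (by simp) (by omega) (by omega) (by omega)
        (by intros; omega)
    rw [hcong x (-1 * a) (by have := dvd_neg.2 ha; exact this.trans (dvd_of_eq (by ring))), this]
    apply hcong
    have := dvd_sub (dvd_neg.2 ha) hdm
    exact this.trans (dvd_of_eq (by ring))
  have hd2 : d ∣ 2 := by
    rw [← hd]
    intro x
    rw [E1 x, E2 (x + 2)]
    rw [show r + 1 - (x + 2) = r - 1 - x by ring]
  have hd2' : d = 2 := by
    have := Int.le_of_dvd (by omega) hd2
    omega
  subst hd2'
  have hne : ∃ x, ¬ (χ (x + 1) ↔ χ x) := by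
    by_contra h; push Not at h; exact hnc h
  obtain ⟨x0, hx0⟩ := hne
  have key : ∀ x, χ (x + 1) ↔ ¬ χ x := by
    intro x
    by_cases hp : (2:ℤ) ∣ x - x0
    · rw [hcong x x0 hp, hcong (x+1) (x0+1) (by omega)]; tauto
    · rw [hcong x (x0+1) (by omega), hcong (x+1) x0 (by omega)]; tauto
  refine ⟨key, ?_⟩
  by_contra hodd
  have e1 := E1 0
  have e2 := hcong (r - 1 - 0) (0+1) (by omega)
  have e3 := key 0
  tauto

theorem mkPath {V : Type*} (G : SimpleGraph V) (m : ℕ) : ∀ (g : ℕ → V),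
    (∀ j < m, G.Adj (g j) (g (j+1))) → (∀ i j, i < j → j ≤ m → g i ≠ g j) →
    ∃ P : G.Walk (g 0) (g m), P.IsPath ∧ P.length = m ∧ ∀ v ∈ P.support, ∃ i ≤ m, v = g i := by
  induction m with
  | zero => intro g _ _; exact ⟨.nil, by simp, by simp, by simp⟩
  | succ m ih =>
    intro g h1 h2
    obtain ⟨P, hP, hl, hs⟩ := ih (fun i => g (i+1)) (fun j hj => h1 _ (by omega))
      (fun i j hij hj => h2 _ _ (by omega) (by omega))
    refine ⟨.cons (h1 0 (by omega)) P, ?_, by simp [hl], ?_⟩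
    · rw [SimpleGraph.Walk.cons_isPath_iff]
      refine ⟨hP, fun hmem => ?_⟩
      obtain ⟨i, hi, he⟩ := hs _ hmem
      exact h2 0 (i+1) (by omega) (by omega) he
    · intro v hv
      rw [SimpleGraph.Walk.support_cons, List.mem_cons] at hv
      rcases hv with rfl | hv
      · exact ⟨0, by omega, rfl⟩
      · obtain ⟨i, hi, he⟩ := hs _ hv
        exact ⟨i+1, by omega, he⟩

theorem main_aux {V : Type*} (G : SimpleGraph V) (n r : ℤ) (hr : 2 ≤ r) (hrn : r ≤ n - 2)
    (f : ℤ → V) (hf : ∀ i j, f i = f j ↔ n ∣ i - j) (hsurj : Function.Surjective f)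
    (hadj : ∀ i, G.Adj (f i) (f (i+1))) (hch : G.Adj (f 0) (f r))
    (hedge : ∀ u v, G.Adj u v → (∃ i, s(u,v) = s(f i, f (i+1))) ∨ s(u,v) = s(f 0, f r))
    (A B : Set V) (hpart : A ∪ B = Set.univ) (hdisj : A ∩ B = ∅)
    (hA : A.Nonempty) (hB : B.Nonempty) (m : ℕ) (hm : 1 ≤ m) (hmn : (m:ℤ) < n)
    (hno : ¬ ∃ (a b : V) (P : G.Walk a b), a ∈ A ∧ b ∈ B ∧ P.IsPath ∧ P.length = m) :
    ∀ u v : V, G.Adj u v → (u ∈ A ∧ v ∈ B) ∨ (u ∈ B ∧ v ∈ A) := by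
  have hB' : ∀ v, v ∈ B ↔ v ∉ A := by
    intro v
    have h1 : v ∈ A ∪ B := hpart ▸ Set.mem_univ v
    have h2 : v ∉ A ∩ B := hdisj ▸ Set.notMem_empty v
    simp only [Set.mem_union, Set.mem_inter_iff] at h1 h2
    tauto
  have := core n r m (fun i => f i ∈ A) (by omega) hmn hr hrn ?_ ?_ ?_
  · obtain ⟨h1, h2⟩ := this
    have h3 : ∀ k : ℕ, (f (2 * k) ∈ A ↔ f 0 ∈ A) := by
      intro k
      induction k with
      | zero => simp
      | succ k ih =>
        have e1 := h1 (2 * k)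
        have e2 := h1 (2 * k + 1)
        rw [show 2 * ((k + 1 : ℕ) : ℤ) = 2 * k + 1 + 1 by push_cast; ring]
        tauto
    have h4 : f r ∈ A ↔ ¬ f 0 ∈ A := by
      have e1 := h3 (r / 2).toNat
      have e2 := h1 (r - 1)
      rw [show 2 * ((r / 2).toNat : ℤ) = r - 1 by omega] at e1
      rw [show r - 1 + 1 = r by ring] at e2
      tauto
    intro u v huv
    simp only [hB']
    rcases hedge u v huv with ⟨i, hi⟩ | hi
    · have := h1 i
      rw [Sym2.eq_iff] at hi
      rcases hi with ⟨rfl, rfl⟩ | ⟨rfl, rfl⟩ <;> tauto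
    · rw [Sym2.eq_iff] at hi
      rcases hi with ⟨rfl, rfl⟩ | ⟨rfl, rfl⟩ <;> tauto
  · intro x
    try dsimp only
    rw [(hf (x + n) x).2 (by simp)]
  · intro hc
    have hup : ∀ (x : ℤ) (k : ℕ), (f (x + k) ∈ A ↔ f x ∈ A) := by
      intro x k
      induction k with
      | zero => simp
      | succ k ih =>
        have := hc (x + k)
        rw [show x + ((k + 1 : ℕ) : ℤ) = x + k + 1 by push_cast; ring]
        tauto
    obtain ⟨a, ha⟩ := hA
    obtain ⟨b, hb⟩ := hB
    obtain ⟨i, rfl⟩ := hsurj a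
    obtain ⟨j, rfl⟩ := hsurj b
    rw [hB'] at hb
    rcases le_total i j with h | h
    · have := hup i (j - i).toNat
      rw [show i + ((j - i).toNat : ℤ) = j by omega] at this
      tauto
    · have := hup j (i - j).toNat
      rw [show j + ((i - j).toNat : ℤ) = i by omega] at this
      tauto
  · intro h h1 h2
    have hex := mkPath G m (fun j => f (h j)) ?_ ?_
    · try simp only [Nat.cast_zero] at hex
      obtain ⟨P, hP, hl, -⟩ := hex
      by_contra hcon
      apply hno
      by_cases h0 : f (h 0) ∈ A
      · exact ⟨_, _, P, h0, by rw [hB']; tauto, hP, hl⟩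
      · exact ⟨_, _, P.reverse, by tauto, by rw [hB']; tauto, hP.reverse, by simpa using hl⟩
    · intro j hj
      have := h1 j (by omega) (by omega)
      try dsimp only
      rw [show ((j + 1 : ℕ) : ℤ) = (j:ℤ) + 1 by push_cast; ring]
      rcases this with e | e | ⟨e, e'⟩
      · rw [e]; exact hadj _
      · rw [e]; have := hadj (h j - 1); rw [sub_add_cancel] at this; exact this.symm
      · rw [e, e']; exact hch
    · intro i j hij hj he
      rw [hf] at he
      obtain ⟨e1, e2, e3⟩ := h2 i j (by omega) (by omega) (by omega)
      have := Int.eq_zero_of_abs_lt_dvd he (by rw [abs_lt]; omega)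
      omega


/-- Lemma of Bondy–Simonovits and Verstraëte: if `G` consists of a Hamiltonian cycle together
with exactly one chord, and `(A, B)` is a non-trivial partition of `V(G)`, then `G` contains
`A`-`B` paths of every length `1 ≤ ℓ < |V(G)|`, unless `G` is bipartite with bipartition
`(A, B)`. -/
theorem stmt_7 {V : Type*} [Fintype V] [DecidableEq V] (G : SimpleGraph V)
    (hG : ∃ (u : V) (c : G.Walk u u), c.IsHamiltonianCycle ∧
      ∃ e : Sym2 V, e ∉ c.edges ∧ G.edgeSet = {e' | e' ∈ c.edges} ∪ {e})
    (A B : Set V) (hpart : A ∪ B = Set.univ) (hdisj : A ∩ B = ∅)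
    (hA : A.Nonempty) (hB : B.Nonempty) :
    (∀ u v : V, G.Adj u v → (u ∈ A ∧ v ∈ B) ∨ (u ∈ B ∧ v ∈ A)) ∨
      ∀ ℓ : ℕ, 1 ≤ ℓ → ℓ < Fintype.card V →
        ∃ (a b : V) (P : G.Walk a b), a ∈ A ∧ b ∈ B ∧ P.IsPath ∧ P.length = ℓ := by
  classical
  obtain ⟨u, c, hc, e, he, hE⟩ := hG
  rw [or_iff_not_imp_right]
  intro hnot
  push Not at hnot
  obtain ⟨m, hm, hmn, hno⟩ := hnot
  set n := c.length with hn
  have hcard : n = Fintype.card V := hc.length_eq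
  have h3 : 3 ≤ n := hc.isCycle.three_le_length
  let f0 : ℤ → V := fun i => c.getVert (i % n).toNat
  have hnat : ∀ i : ℕ, i ≤ n → f0 i = c.getVert i := by
    intro i hi
    rcases hi.lt_or_eq with h | rfl
    · simp only [f0]; congr 1; rw [Int.emod_eq_of_lt (by omega) (by omega)]; simp
    · simp only [f0]; rw [hn]; simp
  have hf0 : ∀ i j, f0 i = f0 j ↔ (n:ℤ) ∣ i - j := by
    intro i j
    have hi1 := Int.emod_nonneg i (b := n) (by omega)
    have hi2 := Int.emod_lt_of_pos i (b := n) (by omega)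
    have hj1 := Int.emod_nonneg j (b := n) (by omega)
    have hj2 := Int.emod_lt_of_pos j (b := n) (by omega)
    constructor
    · intro h
      have := hc.isCycle.getVert_injOn' (x₁ := (i % n).toNat) (x₂ := (j % n).toNat)
        (by simp; omega) (by simp; omega) (by simpa [f0] using h)
      have h' : i % n = j % n := by omega
      exact Int.dvd_of_emod_eq_zero (Int.emod_eq_emod_iff_emod_sub_eq_zero.1 h')
    · intro h
      have : i % n = j % n :=
        Int.emod_eq_emod_iff_emod_sub_eq_zero.2 (Int.emod_eq_zero_of_dvd h)
      simp only [f0]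
      rw [this]
  have hstep : ∀ i : ℤ, ∃ k : ℕ, k < n ∧ f0 i = c.getVert k ∧ f0 (i+1) = c.getVert (k+1) := by
    intro i
    have hi1 := Int.emod_nonneg i (b := n) (by omega)
    have hi2 := Int.emod_lt_of_pos i (b := n) (by omega)
    refine ⟨(i % n).toNat, by omega, rfl, ?_⟩
    rw [← hnat _ (by omega), hf0]
    push_cast
    rw [Int.toNat_of_nonneg hi1]
    have : (n:ℤ) ∣ i - i % n := Int.dvd_self_sub_emod
    exact this.trans (dvd_of_eq (by ring))
  have hadj0 : ∀ i, G.Adj (f0 i) (f0 (i+1)) := by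
    intro i
    obtain ⟨k, hk, e1, e2⟩ := hstep i
    rw [e1, e2]; exact c.adj_getVert_succ hk
  have hmemE : ∀ e', e' ∈ c.edges ↔ ∃ i : ℤ, e' = s(f0 i, f0 (i+1)) := by
    intro e'
    constructor
    · intro h
      rw [List.mem_iff_getElem] at h
      obtain ⟨k, hk, rfl⟩ := h
      have hk' : k < n := by simpa using hk
      refine ⟨k, ?_⟩
      rw [hnat k hk'.le, show ((k:ℤ)+1) = ((k+1 : ℕ):ℤ) by push_cast; ring, hnat _ hk']
      exact c.getElem_edges hk
    · rintro ⟨i, rfl⟩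
      obtain ⟨k, hk, e1, e2⟩ := hstep i
      rw [e1, e2]
      have hk' : k < c.edges.length := by simpa using hk
      rw [← c.getElem_edges hk']
      exact List.getElem_mem _
  have hsurj0 : Function.Surjective f0 := by
    intro v
    have := hc.mem_support v
    rw [SimpleGraph.Walk.mem_support_iff_exists_getVert] at this
    obtain ⟨k, rfl, hk⟩ := this
    exact ⟨k, hnat k hk⟩
  induction e using Sym2.ind with
  | _ x y =>
  have hxy : G.Adj x y := by
    have : s(x,y) ∈ G.edgeSet := by rw [hE]; right; rfl
    exact this
  obtain ⟨p, rfl⟩ := hsurj0 x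
  obtain ⟨q, rfl⟩ := hsurj0 y
  have hr1 := Int.emod_nonneg (q - p) (b := n) (by omega)
  have hr2 := Int.emod_lt_of_pos (q - p) (b := n) (by omega)
  have hr3 : (n:ℤ) ∣ (q - p) - (q - p) % n := Int.dvd_self_sub_emod
  set r := (q - p) % (n:ℤ)
  have hq : f0 q = f0 (p + r) := by
    rw [hf0]; exact hr3.trans (dvd_of_eq (by ring))
  rw [hq] at he hxy hE
  have hr0 : r ≠ 0 := by
    intro h; rw [h, add_zero] at hxy; exact G.loopless.irrefl _ hxy
  have hr1' : r ≠ 1 := by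
    intro h; rw [h] at he; exact he ((hmemE _).2 ⟨p, rfl⟩)
  have hrn' : r ≠ n - 1 := by
    intro h
    apply he
    rw [hmemE]
    refine ⟨p + r, ?_⟩
    rw [Sym2.eq_swap, (hf0 (p + r + 1) p).2 (by rw [h]; ring_nf; simp)]
  refine main_aux G n r (by omega) (by omega) (fun i => f0 (p + i)) ?_ ?_ ?_ ?_ ?_ A B hpart hdisj
    hA hB m hm (by omega) (by push Not; exact hno)
  · intro i j; rw [hf0]; ring_nf
  · intro v
    obtain ⟨i, rfl⟩ := hsurj0 v
    exact ⟨i - p, by simp⟩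
  · intro i
    have := hadj0 (p + i)
    rw [add_assoc] at this; exact this
  · simpa using hxy
  · intro a b hab
    have : s(a,b) ∈ G.edgeSet := hab
    rw [hE] at this
    rcases this with h | h
    · left
      obtain ⟨i, hi⟩ := (hmemE _).1 h
      refine ⟨i - p, ?_⟩
      rw [hi]
      try dsimp only
      rw [show p + (i - p) = i by ring, show p + (i - p + 1) = i + 1 by ring]
    · right
      simpa using h
end

section
/- Let G be a connected finite simple graph of minimum degree at least three and let (A, B) be a non-trivial partition of V(G). Then for every cycle C in G, there exist A-B paths in G of every length ℓ with 1 ≤ ℓ < |V(C)|, unless G is bipartite with bipartition (A, B). -/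
namespace ABPath

variable {V : Type*}

structure Cyc (G : SimpleGraph V) (c : ℤ → V) (n : ℤ) : Prop where
  npos : 3 ≤ n
  per : ∀ i, c (i + n) = c i
  adj : ∀ i, G.Adj (c i) (c (i + 1))
  inj : ∀ i j, i - j < n → j - i < n → c i = c j → i = j

structure IsP (G : SimpleGraph V) (p : ℕ → V) (l : ℕ) : Prop where
  adj : ∀ i < l, G.Adj (p i) (p (i + 1))
  inj : ∀ i j, i ≤ l → j ≤ l → p i = p j → i = j

lemma Cyc.neg {G : SimpleGraph V} {c : ℤ → V} {n : ℤ} (h : Cyc G c n) (r : ℤ) :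
    Cyc G (fun x => c (r - x)) n := by
  refine ⟨h.npos, fun i => ?_, fun i => ?_, fun i j h1 h2 h3 => ?_⟩
  · have := h.per (r - (i + n))
    rw [← this]; congr 1; ring
  · have := (h.adj (r - (i + 1))).symm
    have e : r - (i + 1) + 1 = r - i := by ring
    rwa [e] at this
  · have := h.inj _ _ (by omega) (by omega) h3
    omega

lemma Cyc.shift {G : SimpleGraph V} {c : ℤ → V} {n : ℤ} (h : Cyc G c n) (r : ℤ) :
    Cyc G (fun x => c (r + x)) n := by
  refine ⟨h.npos, fun i => ?_, fun i => ?_, fun i j h1 h2 h3 => ?_⟩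
  · rw [← h.per (r + i)]; congr 1; ring
  · have := h.adj (r + i)
    rwa [add_assoc] at this
  · have := h.inj _ _ (by omega) (by omega) h3
    omega

lemma Cyc.adj' {G : SimpleGraph V} {c : ℤ → V} {n : ℤ} (h : Cyc G c n) {i j : ℤ}
    (hij : j = i + 1 ∨ i = j + 1) : G.Adj (c i) (c j) := by
  rcases hij with rfl | rfl
  · exact h.adj i
  · exact (h.adj j).symm

lemma Cyc.rep {G : SimpleGraph V} {c : ℤ → V} {n : ℤ} (h : Cyc G c n) (i j : ℤ) :
    ∃ r, 0 ≤ r ∧ r < n ∧ c j = c (i + r) := by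
  have hp : Function.Periodic c n := h.per
  refine ⟨(j - i) % n, Int.emod_nonneg _ (by have := h.npos; omega),
    Int.emod_lt_of_pos _ (by have := h.npos; omega), ?_⟩
  have := hp.sub_zsmul_eq (x := j) ((j - i) / n)
  rw [← this]
  congr 1
  have := Int.emod_add_mul_ediv (j - i) n
  simp only [smul_eq_mul]
  linarith

lemma walk_of_fun {G : SimpleGraph V} (p : ℕ → V) (l : ℕ)
    (adj : ∀ i < l, G.Adj (p i) (p (i + 1))) :
    ∃ w : G.Walk (p 0) (p l), w.length = l ∧ w.support = (List.range (l + 1)).map p := by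
  induction l with
  | zero => exact ⟨SimpleGraph.Walk.nil, rfl, by simp⟩
  | succ l ih =>
    obtain ⟨w, h1, h2⟩ := ih (fun i hi => adj i (by omega))
    refine ⟨w.concat (adj l (by omega)), by simp [h1], ?_⟩
    rw [SimpleGraph.Walk.support_concat, h2, List.range_succ (n := l + 1)]
    simp

lemma path_of_fun {G : SimpleGraph V} {p : ℕ → V} {l : ℕ} (h : IsP G p l) :
    ∃ w : G.Walk (p 0) (p l), w.IsPath ∧ w.length = l := by
  obtain ⟨w, h1, h2⟩ := walk_of_fun p l h.adj
  refine ⟨w, ?_, h1⟩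
  rw [SimpleGraph.Walk.isPath_def, h2]
  refine List.Nodup.map_on ?_ List.nodup_range
  intro x hx y hy hxy
  simp only [List.mem_range] at hx hy
  exact h.inj x y (by omega) (by omega) hxy

lemma cyc_of_cycle {G : SimpleGraph V} {u : V} (C : G.Walk u u) (hC : C.IsCycle) :
    ∃ c : ℤ → V, Cyc G c C.length := by
  have h3 := hC.three_le_length
  have hpos : (0 : ℤ) < C.length := by omega
  refine ⟨fun i => C.getVert (i % C.length).toNat, by omega, fun i => by simp, ?_, ?_⟩
  · intro i
    have h0 := Int.emod_nonneg i hpos.ne'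
    have h1 := Int.emod_lt_of_pos i hpos
    have hlt : (i % C.length).toNat < C.length := by omega
    have key := C.adj_getVert_succ hlt
    by_cases hh : i % C.length + 1 < C.length
    · have : (i + 1) % C.length = i % C.length + 1 := by
        rw [Int.add_emod, Int.emod_eq_of_lt (a := 1) (by omega) (by omega),
          Int.emod_eq_of_lt (by omega) hh]
      simp only [this]
      have e : (i % C.length + 1).toNat = (i % C.length).toNat + 1 := by omega
      rw [e]; exact key
    · have e0 : i % C.length + 1 = C.length := by omega
      have : (i + 1) % C.length = 0 := by
        rw [Int.add_emod, Int.emod_eq_of_lt (a := 1) (by omega) (by omega), e0, Int.emod_self]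
      simp only [this]
      have e : (i % C.length).toNat + 1 = C.length := by omega
      rw [e] at key
      simpa using key
  · intro i j h1 h2 h
    have a0 := Int.emod_nonneg i hpos.ne'
    have a1 := Int.emod_lt_of_pos i hpos
    have b0 := Int.emod_nonneg j hpos.ne'
    have b1 := Int.emod_lt_of_pos j hpos
    have := hC.getVert_injOn' (x₁ := (i % C.length).toNat) (x₂ := (j % C.length).toNat)
      (by simp only [Set.mem_ofPred_eq]; omega) (by simp only [Set.mem_ofPred_eq]; omega) h
    have e : i % C.length = j % C.length := by omega
    have hdv : (C.length : ℤ) ∣ i - j := Int.dvd_of_emod_eq_zero (Int.emod_eq_emod_iff_emod_sub_eq_zero.1 e)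
    have := Int.eq_zero_of_abs_lt_dvd hdv (by rw [abs_lt]; omega)
    omega

/-- fill in a `d`-periodic predicate from a window -/
lemma fill (P : ℤ → Prop) (d m : ℤ) (hd : 0 < d) (hP : ∀ x, P (x + d) ↔ P x)
    (h : ∀ x, m ≤ x → x < m + d → P x) (x : ℤ) : P x := by
  have hp : Function.Periodic P d := fun x => propext (hP x)
  have := hp.sub_zsmul_eq (x := x) ((x - m) / d)
  rw [← this]
  have h1 := Int.emod_add_mul_ediv (x - m) d
  have h2 := Int.emod_nonneg (x - m) hd.ne'
  have h3 := Int.emod_lt_of_pos (x - m) hd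
  simp only [smul_eq_mul]
  rw [mul_comm] at h1
  apply h <;> linarith

def Good (G : SimpleGraph V) (χ : V → Prop) (l : ℕ) : Prop :=
  ∀ p : ℕ → V, IsP G p l → (χ (p 0) ↔ χ (p l))

section
variable {G : SimpleGraph V} {χ : V → Prop} {l : ℕ} {c : ℤ → V} {n : ℤ}

lemma per_l (hg : Good G χ l) (hc : Cyc G c n) (hl : (l : ℤ) < n) (x : ℤ) :
    χ (c (x + l)) ↔ χ (c x) := by
  have := hg (fun j => c (x + j)) ⟨fun i _ => hc.adj' (by left; push_cast; ring), fun i j hi hj h => by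
    have := hc.inj _ _ (by omega) (by omega) h
    omega⟩
  simpa using this.symm

/-- two stretches of the cycle joined by a chord -/
lemma t1 (hg : Good G χ l) (hc : Cyc G c n) (hl : (l : ℤ) < n) (r : ℤ)
    (hr : G.Adj (c 0) (c r)) (a : ℤ) (h0 : 0 ≤ a) (h1 : l - r ≤ a) (h2 : a ≤ n - r - 1)
    (h3 : a ≤ l - 1) : χ (c (-a)) ↔ χ (c (r + 1 + a)) := by
  have := hg (fun j => c (if (j : ℤ) ≤ a then -a + j else r - (j - a - 1))) ⟨fun i hi => ?_,
    fun i j hi hj h => ?_⟩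
  · have e := per_l hg hc hl (r - (l - a - 1))
    have e1 : r - ((l:ℤ) - a - 1) + l = r + 1 + a := by ring
    rw [e1] at e
    rw [e]
    simpa [h0, show ¬ ((l:ℤ) ≤ a) by omega] using this
  · rcases lt_trichotomy (i : ℤ) a with h | h | h
    · simp only [show (i : ℤ) ≤ a by omega, show ((i + 1 : ℕ) : ℤ) ≤ a by omega, if_true]
      apply hc.adj'; omega
    · simp only [show (i : ℤ) ≤ a by omega, show ¬ ((i + 1 : ℕ) : ℤ) ≤ a by omega, if_true, if_false]
      have e1 : -a + (i : ℤ) = 0 := by omega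
      have e2 : r - (((i + 1 : ℕ) : ℤ) - a - 1) = r := by omega
      rw [e1, e2]; exact hr
    · simp only [show ¬ (i : ℤ) ≤ a by omega, show ¬ ((i + 1 : ℕ) : ℤ) ≤ a by omega, if_false]
      apply hc.adj'; omega
  · have := hc.inj _ _ (by split_ifs <;> omega) (by split_ifs <;> omega) h
    split_ifs at this <;> omega

lemma t3 (hg : Good G χ l) (hc : Cyc G c n) (hl : (l : ℤ) < n) (r : ℤ) (hr0 : 1 ≤ r)
    (hr : G.Adj (c 0) (c r)) (hlr : l ≤ n - r) (a : ℤ) (h0 : 0 ≤ a)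
    (h3 : a ≤ l - 1) : χ (c (-a)) ↔ χ (c (r - 1 - a)) := by
  have := hg (fun j => c (if (j : ℤ) ≤ a then -a + j else r + (j - a - 1))) ⟨fun i hi => ?_,
    fun i j hi hj h => ?_⟩
  · have e := per_l hg hc hl (r - 1 - a)
    have e1 : r + ((l:ℤ) - a - 1) = r - 1 - a + l := by ring
    rw [← e, ← e1]
    simpa [h0, show ¬ ((l:ℤ) ≤ a) by omega] using this
  · rcases lt_trichotomy (i : ℤ) a with h | h | h
    · simp only [show (i : ℤ) ≤ a by omega, show ((i + 1 : ℕ) : ℤ) ≤ a by omega, if_true]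
      apply hc.adj'; omega
    · simp only [show (i : ℤ) ≤ a by omega, show ¬ ((i + 1 : ℕ) : ℤ) ≤ a by omega, if_true, if_false]
      have e1 : -a + (i : ℤ) = 0 := by omega
      have e2 : r + (((i + 1 : ℕ) : ℤ) - a - 1) = r := by omega
      rw [e1, e2]; exact hr
    · simp only [show ¬ (i : ℤ) ≤ a by omega, show ¬ ((i + 1 : ℕ) : ℤ) ≤ a by omega, if_false]
      apply hc.adj'; omega
  · have := hc.inj _ _ (by split_ifs <;> omega) (by split_ifs <;> omega) h
    split_ifs at this <;> omega

/-- `d` is the least positive period of the colouring along the cycle -/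
structure MinPer (χ : V → Prop) (c : ℤ → V) (d : ℤ) : Prop where
  pos : 0 < d
  per : ∀ x, χ (c (x + d)) ↔ χ (c x)
  min : ∀ e, 0 < e → (∀ x, χ (c (x + e)) ↔ χ (c x)) → d ≤ e

lemma exists_minPer (hc : Cyc G c n) : ∃ d, MinPer χ c d := by
  classical
  have hn := hc.npos
  have hex : ∃ e : ℕ, 0 < e ∧ ∀ x, χ (c (x + (e : ℤ))) ↔ χ (c x) :=
    ⟨n.toNat, by omega, fun x => by rw [Int.toNat_of_nonneg (by omega), hc.per]⟩
  obtain ⟨h1, h2⟩ := Nat.find_spec hex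
  refine ⟨(Nat.find hex : ℕ), by exact_mod_cast h1, h2, fun e he h => ?_⟩
  have := Nat.find_min' hex (m := e.toNat) ⟨by omega, by
    rw [Int.toNat_of_nonneg (by omega)]; exact h⟩
  omega

lemma MinPer.dvd {d : ℤ} (h : MinPer χ c d) (e : ℤ) (he : ∀ x, χ (c (x + e)) ↔ χ (c x)) :
    d ∣ e := by
  by_contra hnd
  have h0 := Int.emod_nonneg e h.pos.ne'
  have h1 := Int.emod_lt_of_pos e h.pos
  have h2 : e % d ≠ 0 := fun h => hnd (Int.dvd_of_emod_eq_zero h)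
  have hp : Function.Periodic (fun x => χ (c x)) d := fun x => propext (h.per x)
  have := h.min (e % d) (by omega) (fun x => by
    have := hp.sub_zsmul_eq (x := x + e) (e / d)
    simp only [smul_eq_mul] at this
    rw [← he x, ← this]
    have := Int.emod_add_mul_ediv e d
    have e2 : x + e - e / d * d = x + e % d := by linarith
    rw [e2])
  omega

lemma MinPer.shift {d : ℤ} (h : MinPer χ c d) (r : ℤ) : MinPer χ (fun x => c (r + x)) d := by
  refine ⟨h.pos, fun x => by rw [← add_assoc]; exact h.per _, fun e he hx => h.min e he fun x => ?_⟩
  have := hx (x - r)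
  have e1 : r + (x - r + e) = x + e := by ring
  have e2 : r + (x - r) = x := by ring
  rwa [e1, e2] at this

/-- A chord whose span is shorter than the period is impossible. -/
lemma short_chord (hg : Good G χ l) (hc : Cyc G c n) (hl : (l : ℤ) < n) {d : ℤ}
    (hd : MinPer χ c d) (hdl : d ≤ l) (hdn : l + d ≤ n) (r : ℤ) (hr0 : 2 ≤ r)
    (hr : G.Adj (c 0) (c r)) : d ≤ r := by
  by_contra hlt
  have key : ∀ a, χ (c (-a)) ↔ χ (c (r - 1 - a)) := by
    refine fill _ d 0 hd.pos (fun a => ?_) (fun a h0 h1 =>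
      t3 hg hc hl r (by omega) hr (by omega) a h0 (by omega))
    have e1 := hd.per (-(a + d))
    have e2 := hd.per (r - 1 - (a + d))
    rw [show -(a + d) + d = -a by ring] at e1
    rw [show r - 1 - (a + d) + d = r - 1 - a by ring] at e2
    rw [e1, e2]
  have := hd.min (r - 1) (by omega) (fun x => by
    have := key (-x)
    rw [neg_neg, show r - 1 - -x = x + (r - 1) by ring] at this
    exact this.symm)
  omega

lemma chord0 (hg : Good G χ l) (hl0 : 1 ≤ l) (hc : Cyc G c n) (hl : (l : ℤ) < n) (r : ℤ)
    (hr0 : 2 ≤ r) (hrn : r ≤ n - 2) (hr : G.Adj (c 0) (c r)) :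
    (∀ x, χ (c (x + 2)) ↔ χ (c x)) ∧ (χ (c 0) ↔ χ (c (r + 1))) := by
  obtain ⟨d, hd⟩ := exists_minPer (χ := χ) hc
  have hdl := hd.dvd l (per_l hg hc hl)
  have hdn := hd.dvd n (fun x => by rw [hc.per])
  have h1 : d ≤ l := Int.le_of_dvd (by omega) hdl
  have h2 : d ≤ n - l := Int.le_of_dvd (by omega) (Int.dvd_sub hdn hdl)
  have hdr : d ≤ r := short_chord hg hc hl hd h1 (by omega) r hr0 hr
  have hdr' : d ≤ n - r := by
    refine short_chord hg (hc.shift r) hl (hd.shift r) h1 (by omega) (n - r) (by omega) ?_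
    have := hc.per 0
    rw [zero_add] at this
    simp only [add_zero, add_sub_cancel, this]
    exact hr.symm
  have gen : ∀ c' : ℤ → V, Cyc G c' n → (∀ x, χ (c' (x + d)) ↔ χ (c' x)) → G.Adj (c' 0) (c' r) →
      ∀ a, χ (c' (-a)) ↔ χ (c' (r + 1 + a)) := by
    intro c' hc' hd' hr'
    refine fill _ d (max 0 (l - r)) hd.pos (fun a => ?_) (fun a h0 h1 =>
      t1 hg hc' hl r hr' a (by omega) (by omega) (by omega) (by omega))
    have e1 := hd' (-(a + d))
    have e2 := hd' (r + 1 + a)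
    rw [show -(a + d) + d = -a by ring] at e1
    rw [show r + 1 + a + d = r + 1 + (a + d) by ring] at e2
    rw [e1, e2]
  have k1 := gen c hc hd.per hr
  have k2 := gen _ (hc.neg r) (fun x => by
    have := hd.per (r - (x + d))
    rw [show r - (x + d) + d = r - x by ring] at this
    exact this.symm) (by simpa using hr.symm)
  refine ⟨fun x => ?_, by simpa using k1 0⟩
  have a1 := k1 (-x - 2)
  have a2 := k2 (-x - 1)
  rw [show -(-x - 2) = x + 2 by ring] at a1
  rw [show r - -(-x-1) = r + 1 + (-x - 2) by ring, show r - (r + 1 + (-x-1)) = x by ring] at a2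
  rw [a1, a2]

lemma chord (hg : Good G χ l) (hl0 : 1 ≤ l) (hc : Cyc G c n) (hl : (l : ℤ) < n) (i r : ℤ)
    (hr0 : 2 ≤ r) (hrn : r ≤ n - 2) (hr : G.Adj (c i) (c (i + r))) :
    (∀ x, χ (c (x + 2)) ↔ χ (c x)) ∧ (χ (c i) ↔ χ (c (i + r + 1))) := by
  obtain ⟨h1, h2⟩ := chord0 hg hl0 (hc.shift i) hl r hr0 hrn (by simpa using hr)
  refine ⟨fun x => ?_, by simpa [add_assoc] using h2⟩
  have := h1 (x - i)
  rwa [show i + (x - i + 2) = x + 2 by ring, show i + (x - i) = x by ring] at this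

/-- a path leaving the cycle at `c i` -/
structure Root (G : SimpleGraph V) (c : ℤ → V) (q : ℕ → V) (k : ℕ) (i : ℤ) : Prop where
  path : IsP G q k
  start : q 0 = c i
  off : ∀ j, 1 ≤ j → j ≤ k → ∀ x, q j ≠ c x

lemma Root.trunc {q : ℕ → V} {k : ℕ} {i : ℤ} (h : Root G c q k i) {m : ℕ} (hm : m ≤ k) :
    Root G c q m i :=
  ⟨⟨fun j hj => h.path.adj j (by omega), fun a b ha hb => h.path.inj a b (by omega) (by omega)⟩,
    h.start, fun j h1 h2 => h.off j h1 (by omega)⟩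

lemma Root.snoc {q : ℕ → V} {k : ℕ} {i : ℤ} (h : Root G c q k i) {y : V} (hy : G.Adj (q k) y)
    (hoff : ∀ x, y ≠ c x) (hq : ∀ j ≤ k, q j ≠ y) :
    Root G c (fun j => if j ≤ k then q j else y) (k + 1) i := by
  refine ⟨⟨fun j hj => ?_, fun a b ha hb hab => ?_⟩, by simp [h.start], fun j h1 h2 => ?_⟩
  · by_cases hjk : j < k
    · simp only [show j ≤ k by omega, show j + 1 ≤ k by omega, if_true]
      exact h.path.adj j hjk
    · obtain rfl : j = k := by omega
      simpa using hy
  · skip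
    split_ifs at hab with h1 h2 h2
    · exact h.path.inj a b h1 h2 hab
    · exact absurd hab (hq a h1)
    · exact absurd hab.symm (hq b h2)
    · omega
  · skip
    split_ifs with h3
    · exact h.off j h1 h3
    · exact hoff

lemma Root.ext {q : ℕ → V} {k : ℕ} {i : ℤ} (h : Root G c q k i) {y : V} (hy : G.Adj (q k) y)
    (hoff : ∀ x, y ≠ c x) : ∃ q' k', Root G c q' (k' + 1) i ∧
      ((q' k' = q k ∧ q' (k' + 1) = y) ∨ (q' k' = y ∧ q' (k' + 1) = q k)) := by
  by_cases hq : ∀ j ≤ k, q j ≠ y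
  · exact ⟨_, k, h.snoc hy hoff hq, Or.inl (by simp)⟩
  · push Not at hq
    obtain ⟨j, hj, rfl⟩ := hq
    have hj0 : j ≠ 0 := by
      rintro rfl
      exact hoff i h.start
    have hjk : j ≠ k := by
      rintro rfl
      exact G.loopless.irrefl _ hy
    refine ⟨_, j, (h.trunc hj).snoc hy.symm (h.off k (by omega) le_rfl) (fun m hm e => ?_),
      Or.inr (by simp)⟩
    have := h.path.inj m k (by omega) le_rfl e
    omega

lemma exists_root (hconn : G.Connected) (w : V) : ∃ q k i, Root G c q k i ∧ q k = w := by
  have base : ∀ i, ∃ q k i', Root G c q k i' ∧ q k = c i := fun i =>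
    ⟨fun _ => c i, 0, i, ⟨⟨fun j hj => by omega, fun a b ha hb _ => by omega⟩, rfl,
      fun j h1 h2 => by omega⟩, rfl⟩
  obtain ⟨p⟩ := hconn.preconnected w (c 0)
  generalize hv : c 0 = v at p
  induction p with
  | nil => exact hv ▸ base 0
  | @cons x y z hxy p ih =>
    by_cases hoff : ∀ i, x ≠ c i
    · obtain ⟨q, k, i, hq, rfl⟩ := ih hv
      obtain ⟨q', k', h1, h2⟩ := hq.ext hxy.symm hoff
      rcases h2 with ⟨_, h2⟩ | ⟨h2, _⟩
      · exact ⟨q', k' + 1, i, h1, h2⟩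
      · exact ⟨q', k', i, h1.trunc (by omega), h2⟩
    · push Not at hoff
      obtain ⟨i, rfl⟩ := hoff
      exact base i

lemma root_color (hg : Good G χ l) (hl0 : 1 ≤ l) (hc : Cyc G c n) (hl : (l : ℤ) < n)
    {q : ℕ → V} {k : ℕ} {i : ℤ} (h : Root G c q k i) : χ (q k) ↔ χ (c (i - k)) := by
  induction k using Nat.strong_induction_on with
  | _ k ih =>
    by_cases hk : k ≤ l
    · have := hg (fun j => if j ≤ k then q (k - j) else c (i + (j - k))) ⟨fun j hj => ?_,
        fun a b ha hb hab => ?_⟩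
      · have e := per_l hg hc hl (i - k)
        rw [← e]
        rcases hk.eq_or_lt with rfl | hlt
        · simpa [h.start] using this
        · simp only [Nat.zero_le, if_true, Nat.sub_zero, show ¬ l ≤ k by omega, if_false] at this
          rw [this, show i - (k : ℤ) + l = i + (l - k) by ring]
      · rcases lt_trichotomy j k with hh | hh | hh
        · simp only [show j ≤ k by omega, show j + 1 ≤ k by omega, if_true]
          have := h.path.adj (k - (j + 1)) (by omega)
          rw [show k - (j + 1) + 1 = k - j by omega] at this
          exact this.symm
        · subst hh
          simp only [le_refl, show ¬ j + 1 ≤ j by omega, if_true, if_false, Nat.sub_self, h.start]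
          apply hc.adj'; omega
        · simp only [show ¬ j ≤ k by omega, show ¬ j + 1 ≤ k by omega, if_false]
          apply hc.adj'; omega
      · have aux : ∀ a b : ℕ, a ≤ k → k < b → b ≤ l → q (k - a) ≠ c (i + (b - k)) := by
          intro a b ha hb hbl e
          rcases ha.eq_or_lt with rfl | hlt
          · rw [Nat.sub_self, h.start] at e
            have := hc.inj _ _ (by omega) (by omega) e
            omega
          · exact h.off _ (by omega) (by omega) _ e
        split_ifs at hab with h1 h2 h2
        · have := h.path.inj _ _ (by omega) (by omega) hab
          omega
        · exact absurd hab (aux a b h1 (by omega) hb)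
        · exact absurd hab.symm (aux b a h2 (by omega) ha)
        · have := hc.inj _ _ (by omega) (by omega) hab
          omega
    · have h1 := ih (k - l) (by omega) (h.trunc (by omega))
      have h2 := hg (fun j => q (k - l + j)) ⟨fun j hj => h.path.adj _ (by omega),
        fun a b ha hb hab => by
          have := h.path.inj _ _ (by omega) (by omega) hab
          omega⟩
      simp only [add_zero, show k - l + l = k by omega] at h2
      rw [← h2, h1, ← per_l hg hc hl (i - k), Nat.cast_sub (by omega),
        show i - ((k : ℤ) - l) = i - k + l by ring]

lemma Root.neg {q : ℕ → V} {k : ℕ} {i : ℤ} (h : Root G c q k i) :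
    Root G (fun x => c (0 - x)) q k (-i) :=
  ⟨h.path, by simp [h.start], fun j h1 h2 x => h.off j h1 h2 _⟩

/-- the neighbours of a cycle vertex off the cycle and on it agree -/
lemma two_step [Fintype V] [DecidableRel G.Adj] (hdeg : ∀ v : V, 3 ≤ G.degree v)
    (hg : Good G χ l) (hl0 : 1 ≤ l) (hc : Cyc G c n) (hl : (l : ℤ) < n) (i : ℤ) :
    χ (c (i + 1)) ↔ χ (c (i - 1)) := by
  classical
  obtain ⟨w, hw, hw2⟩ : ∃ w ∈ G.neighborFinset (c i), w ∉ ({c (i + 1), c (i - 1)} : Finset V) := by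
    apply Finset.exists_mem_notMem_of_card_lt_card
    rw [SimpleGraph.card_neighborFinset_eq_degree]
    have := hdeg (c i)
    have := Finset.card_le_two (a := c (i + 1)) (b := c (i - 1))
    omega
  rw [SimpleGraph.mem_neighborFinset] at hw
  simp only [Finset.mem_insert, Finset.mem_singleton, not_or] at hw2
  by_cases hoff : ∀ x, w ≠ c x
  · have hr : Root G c (fun _ => c i) 0 i :=
      ⟨⟨fun j hj => by omega, fun a b ha hb _ => by omega⟩, rfl, fun j h1 h2 => by omega⟩
    have hr' := hr.snoc hw hoff (fun j _ => hw.ne)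
    have e1 := root_color hg hl0 hc hl hr'
    have e2 := root_color hg hl0 (hc.neg 0) hl hr'.neg
    simp only [show ¬ (0 + 1 ≤ 0) by omega, if_false] at e1 e2
    rw [show 0 - (-i - ((0 + 1 : ℕ) : ℤ)) = i + 1 by push_cast; ring] at e2
    rw [show i - ((0 + 1 : ℕ) : ℤ) = i - 1 by push_cast; ring] at e1
    rw [← e1, ← e2]
  · push Not at hoff
    obtain ⟨j, rfl⟩ := hoff
    obtain ⟨r, h0, h1, hr⟩ := hc.rep i j
    rw [hr] at hw hw2
    have r0 : r ≠ 0 := by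
      rintro rfl
      rw [add_zero] at hw
      exact G.loopless.irrefl _ hw
    have r1 : r ≠ 1 := by
      rintro rfl
      exact hw2.1 rfl
    have r2 : r ≠ n - 1 := by
      rintro rfl
      apply hw2.2
      rw [← hc.per (i - 1)]
      congr 1; ring
    have := (chord hg hl0 hc hl i r (by omega) (by omega) hw).1 (i - 1)
    rwa [show i - 1 + 2 = i + 1 by ring] at this

lemma main [Fintype V] [DecidableRel G.Adj] (hconn : G.Connected) (hdeg : ∀ v : V, 3 ≤ G.degree v)
    (hg : Good G χ l) (hl0 : 1 ≤ l) (hc : Cyc G c n) (hl : (l : ℤ) < n)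
    (hA : ∃ v, χ v) (hB : ∃ v, ¬ χ v) (u v : V) (huv : G.Adj u v) : χ u ↔ ¬ χ v := by
  have per2 : ∀ x, χ (c (x + 2)) ↔ χ (c x) := fun x => by
    have := two_step hdeg hg hl0 hc hl (x + 1)
    rwa [show x + 1 + 1 = x + 2 by ring, show x + 1 - 1 = x by ring] at this
  have alt : ∀ x, χ (c (x + 1)) ↔ ¬ χ (c x) := by
    by_contra hno
    push Not at hno
    obtain ⟨x, hx⟩ := hno
    have hx' : χ (c (x + 1)) ↔ χ (c x) := by tauto
    have mono : ∀ y, χ (c y) ↔ χ (c x) := by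
      refine fill _ 2 x (by omega) (fun y => by rw [per2]) (fun y h1 h2 => ?_)
      obtain rfl | rfl : y = x ∨ y = x + 1 := by omega
      · rfl
      · exact hx'
    have all : ∀ w, χ w ↔ χ (c x) := fun w => by
      obtain ⟨q, k, i, hq, rfl⟩ := exists_root (c := c) hconn w
      rw [root_color hg hl0 hc hl hq, mono]
    obtain ⟨a, ha⟩ := hA
    obtain ⟨b, hb⟩ := hB
    rw [all] at ha hb
    exact hb ha
  have edge : ∀ u v, G.Adj u v → (∀ x, v ≠ c x) → (χ u ↔ ¬ χ v) := by
    intro u v huv hv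
    obtain ⟨q, k, i, hq, rfl⟩ := exists_root (c := c) hconn u
    obtain ⟨q', k', h1, h2⟩ := hq.ext huv hv
    have e1 := root_color hg hl0 hc hl h1
    have e2 := root_color hg hl0 hc hl (h1.trunc (Nat.le_succ k'))
    have e3 := alt (i - (k' + 1 : ℕ))
    rw [show i - ((k' + 1 : ℕ) : ℤ) + 1 = i - k' by push_cast; ring] at e3
    rcases h2 with ⟨h2, h3⟩ | ⟨h2, h3⟩ <;> rw [h2] at e2 <;> rw [h3] at e1 <;> tauto
  by_cases hv : ∀ x, v ≠ c x
  · exact edge u v huv hv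
  by_cases hu : ∀ x, u ≠ c x
  · have := edge v u huv.symm hu
    tauto
  push Not at hu hv
  obtain ⟨i, rfl⟩ := hu
  obtain ⟨j, rfl⟩ := hv
  obtain ⟨r, h0, h1, hr⟩ := hc.rep i j
  rw [hr] at huv ⊢
  have r0 : r ≠ 0 := by
    rintro rfl
    rw [add_zero] at huv
    exact G.loopless.irrefl _ huv
  by_cases r1 : r = 1
  · subst r1
    have := alt i
    tauto
  by_cases r2 : r = n - 1
  · subst r2
    have e := hc.per (i - 1)
    rw [show i - 1 + n = i + (n - 1) by ring] at e
    rw [e]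
    have := alt (i - 1)
    rwa [sub_add_cancel] at this
  have e := (chord hg hl0 hc hl i r (by omega) (by omega) huv).2
  rw [e, alt]

end

end ABPath

/-- Modified `A`-`B` path lemma: let `G` be a connected graph of minimum degree at least three
and `(A, B)` a non-trivial partition of `V(G)`. Then for any cycle `C` in `G` there are
`A`-`B` paths of every length `1 ≤ ℓ < |V(C)|`, unless `G` is bipartite with bipartition
`(A, B)`. (For a cycle `C`, the number of vertices `|V(C)|` equals its length.) -/
theorem stmt_8 {V : Type*} [Fintype V] (G : SimpleGraph V) [DecidableRel G.Adj]
    (hconn : G.Connected) (hdeg : ∀ v : V, 3 ≤ G.degree v)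
    (A B : Set V) (hpart : A ∪ B = Set.univ) (hdisj : A ∩ B = ∅)
    (hA : A.Nonempty) (hB : B.Nonempty) :
    (∀ u v : V, G.Adj u v → (u ∈ A ∧ v ∈ B) ∨ (u ∈ B ∧ v ∈ A)) ∨
      ∀ (u : V) (C : G.Walk u u), C.IsCycle →
        ∀ ℓ : ℕ, 1 ≤ ℓ → ℓ < C.length →
          ∃ (a b : V) (P : G.Walk a b), a ∈ A ∧ b ∈ B ∧ P.IsPath ∧ P.length = ℓ := by
  rw [or_iff_not_imp_right]
  intro hno
  push Not at hno
  obtain ⟨u, C, hC, l, hl0, hl, hno⟩ := hno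
  obtain ⟨c, hc⟩ := ABPath.cyc_of_cycle C hC
  have hAB : ∀ v, v ∈ B ↔ ¬ v ∈ A := fun v => by
    have h1 : v ∈ A ∪ B := hpart ▸ Set.mem_univ v
    have h2 : v ∉ A ∩ B := by rw [hdisj]; exact Set.notMem_empty v
    simp only [Set.mem_union, Set.mem_inter_iff] at h1 h2
    tauto
  have hg : ABPath.Good G (· ∈ A) l := by
    intro p hp
    obtain ⟨w, hw, hwl⟩ := ABPath.path_of_fun hp
    by_contra hne
    by_cases h0 : p 0 ∈ A
    · exact hno _ _ w h0 ((hAB _).2 (by tauto)) hw hwl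
    · exact hno _ _ w.reverse (by tauto) ((hAB _).2 h0) hw.reverse (by simpa using hwl)
  intro x y hxy
  have := ABPath.main hconn hdeg hg hl0 hc (by exact_mod_cast hl) hA
    (hB.imp fun v hv => (hAB v).1 hv) x y hxy
  rw [hAB, hAB]
  by_cases hx : x ∈ A <;> by_cases hy : y ∈ A <;> simp_all
end
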